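/- arXiv:1403.4176 — 4 statements merged into one kernel-verified Lean document; each statement's English description precedes it below -/
import Mathlib

section
/- For two homogeneous harmonic polynomials P, Q of degree d on ℝⁿ, the mean value of P·Q over the unit sphere equals 1/(d(2d+n-2)) times the sum over i of the mean values of (∂ᵢP)·(∂ᵢQ) over the unit sphere. -/
open MeasureTheory Metric

noncomputable section

abbrev E (n : ℕ) := EuclideanSpace ℝ (Fin n)

noncomputable def lap (n : ℕ) (f : E n → ℝ) (x : E n) : ℝ :=
  ∑ i : Fin n, fderiv ℝ (fun y => fderiv ℝ f y (EuclideanSpace.single i 1)) x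
    (EuclideanSpace.single i 1)

def IsHHP (n d : ℕ) (P : E n → ℝ) : Prop :=
  (∃ p : MvPolynomial (Fin n) ℝ, p.IsHomogeneous d ∧
      ∀ x : E n, P x = MvPolynomial.eval (fun i => x i) p)
  ∧ ∀ x, lap n P x = 0

noncomputable def sAvg (n : ℕ) (f : E n → ℝ) : ℝ :=
  ⨍ y : sphere (0 : E n) 1, f (y : E n) ∂((volume : Measure (E n)).toSphere)

noncomputable def sInner (n : ℕ) (f g : E n → ℝ) : ℝ := sAvg n (fun x => f x * g x)

noncomputable def sNorm (n : ℕ) (f : E n → ℝ) : ℝ := Real.sqrt (sAvg n fun x => f x ^ 2)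

noncomputable def pd (n : ℕ) (i : Fin n) (f : E n → ℝ) (x : E n) : ℝ :=
  fderiv ℝ f x (EuclideanSpace.single i 1)

section Polar

open Measure

theorem integral_pow_mul_exp_neg_sq_volumeIoiPow (k m : ℕ) :
    ∫ r : Set.Ioi (0 : ℝ), (r : ℝ) ^ k * Real.exp (-(r : ℝ) ^ 2) ∂volumeIoiPow m =
      1 / 2 * Real.Gamma ((k + m + 1) / 2) := by
  have h := integral_rpow_mul_exp_neg_rpow (p := 2) (q := ((k + m : ℕ) : ℝ)) two_pos
    (by have := Nat.cast_nonneg (α := ℝ) (k + m); linarith)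
  push_cast at h
  rw [← h, Measure.volumeIoiPow]
  simp only [ENNReal.ofReal]
  rw [integral_withDensity_eq_integral_smul (measurable_subtype_coe.pow_const _).real_toNNReal,
    integral_subtype_comap measurableSet_Ioi
      fun a : ℝ ↦ Real.toNNReal (a ^ m) • (a ^ k * Real.exp (-a ^ 2))]
  refine setIntegral_congr_fun measurableSet_Ioi fun x hx ↦ ?_
  have hx' : (0 : ℝ) < x := hx
  simp only [NNReal.smul_def, Real.coe_toNNReal _ (pow_nonneg hx'.le _), smul_eq_mul]
  rw [Real.rpow_add hx']
  simp only [Real.rpow_natCast, Real.rpow_two]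
  ring

theorem integrable_pow_mul_exp_neg_sq_volumeIoiPow (k m : ℕ) :
    Integrable (fun r : Set.Ioi (0 : ℝ) ↦ (r : ℝ) ^ k * Real.exp (-(r : ℝ) ^ 2))
      (volumeIoiPow m) := by
  refine .of_integral_ne_zero ?_
  rw [integral_pow_mul_exp_neg_sq_volumeIoiPow]
  have : 0 < Real.Gamma ((k + m + 1 : ℝ) / 2) := Real.Gamma_pos_of_pos (by positivity)
  positivity

variable {V : Type*} [NormedAddCommGroup V] [NormedSpace ℝ V] {f : V → ℝ} {k : ℕ}

theorem mul_exp_neg_norm_sq_eq_of_homogeneous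
    (hom : ∀ (r : ℝ) (x : V), f (r • x) = r ^ k * f x) (x : ({0}ᶜ : Set V)) :
    f x * Real.exp (-‖(x : V)‖ ^ 2) =
      f (homeomorphUnitSphereProd V x).1 *
        (((homeomorphUnitSphereProd V x).2 : ℝ) ^ k *
          Real.exp (-((homeomorphUnitSphereProd V x).2 : ℝ) ^ 2)) := by
  have hx : ‖(x : V)‖ ≠ 0 := norm_ne_zero_iff.2 x.2
  simp only [homeomorphUnitSphereProd_apply_snd_coe, homeomorphUnitSphereProd_apply_fst_coe, hom]
  field_simp
  simp [hx]

variable [FiniteDimensional ℝ V] [Nontrivial V] [MeasurableSpace V] [BorelSpace V]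
  (μ : Measure V) [μ.IsAddHaarMeasure]

theorem integrable_mul_exp_neg_norm_sq_of_homogeneous (hf : Continuous f)
    (hom : ∀ (r : ℝ) (x : V), f (r • x) = r ^ k * f x) :
    Integrable (fun x ↦ f x * Real.exp (-‖x‖ ^ 2)) μ := by
  rw [← restrict_compl_singleton (μ := μ) 0, ← IntegrableOn,
    integrableOn_iff_comap_subtypeVal (by measurability)]
  have hs : Integrable (fun y : sphere (0 : V) 1 ↦ f y) μ.toSphere :=
    (hf.comp continuous_subtype_val).integrable_of_hasCompactSupport
      (HasCompactSupport.of_compactSpace _)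
  have := (μ.measurePreserving_homeomorphUnitSphereProd.integrable_comp_emb
    (Homeomorph.measurableEmbedding _)).2
      (hs.mul_prod (integrable_pow_mul_exp_neg_sq_volumeIoiPow k (Module.finrank ℝ V - 1)))
  exact this.congr (.of_forall fun x ↦ (mul_exp_neg_norm_sq_eq_of_homogeneous hom x).symm)

theorem integral_mul_exp_neg_norm_sq_of_homogeneous
    (hom : ∀ (r : ℝ) (x : V), f (r • x) = r ^ k * f x) :
    ∫ x, f x * Real.exp (-‖x‖ ^ 2) ∂μ =
      (∫ y : sphere (0 : V) 1, f y ∂μ.toSphere) *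
        (1 / 2 * Real.Gamma ((k + Module.finrank ℝ V) / 2)) := by
  have hdim : ((Module.finrank ℝ V - 1 : ℕ) : ℝ) + 1 = Module.finrank ℝ V := by
    exact_mod_cast Nat.sub_add_cancel (Module.finrank_pos (R := ℝ) (M := V))
  rw [← hdim, ← add_assoc, ← integral_pow_mul_exp_neg_sq_volumeIoiPow, ← integral_prod_mul,
    ← μ.measurePreserving_homeomorphUnitSphereProd.integral_comp
      (Homeomorph.measurableEmbedding _),
    ← restrict_compl_singleton (μ := μ) 0,
    ← integral_subtype_comap (measurableSet_singleton _).compl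
      fun x : V ↦ f x * Real.exp (-‖x‖ ^ 2), restrict_compl_singleton]
  exact integral_congr_ae (.of_forall fun x ↦ mul_exp_neg_norm_sq_eq_of_homogeneous hom x)

end Polar

section Polynomial

open MvPolynomial

variable {n : ℕ}

theorem hasFDerivAt_eval (p : MvPolynomial (Fin n) ℝ) (x : E n) :
    HasFDerivAt (fun y : E n ↦ eval (fun i ↦ y i) p)
      (∑ i, eval (fun j ↦ x j) (pderiv i p) • EuclideanSpace.proj (𝕜 := ℝ) i) x := by
  induction p using MvPolynomial.induction_on with
  | C a => simpa using hasFDerivAt_const a x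
  | add p q hp hq =>
    simp only [map_add, add_smul, Finset.sum_add_distrib]
    exact hp.add hq
  | mul_X p j hp =>
    have hj : HasFDerivAt (fun y : E n ↦ y j) (EuclideanSpace.proj (𝕜 := ℝ) j : E n →L[ℝ] ℝ) x :=
      (EuclideanSpace.proj (𝕜 := ℝ) j : E n →L[ℝ] ℝ).hasFDerivAt
    simp only [map_mul, eval_X]
    refine (hp.mul hj).congr_fderiv ?_
    ext v
    simp [pderiv_X, Pi.single_apply, Finset.mul_sum, add_mul, Finset.sum_add_distrib,
      mul_assoc, apply_ite]

theorem pd_eval (i : Fin n) (p : MvPolynomial (Fin n) ℝ) :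
    pd n i (fun y ↦ eval (fun j ↦ y j) p) = fun x ↦ eval (fun j ↦ x j) (pderiv i p) := by
  ext x
  simp [pd, (hasFDerivAt_eval p x).fderiv]

theorem lap_eval (p : MvPolynomial (Fin n) ℝ) (x : E n) :
    lap n (fun y ↦ eval (fun j ↦ y j) p) x =
      eval (fun j ↦ x j) (∑ i, pderiv i (pderiv i p)) := by
  have h (i : Fin n) (q : MvPolynomial (Fin n) ℝ) (x : E n) := congrFun (pd_eval i q) x
  simp only [pd] at h
  simp only [lap, h, map_sum]

theorem continuous_eval_euclidean (p : MvPolynomial (Fin n) ℝ) :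
    Continuous fun x : E n ↦ eval (fun i ↦ x i) p :=
  continuous_iff_continuousAt.2 fun x ↦ (hasFDerivAt_eval p x).continuousAt

theorem eval_smul_of_isHomogeneous {p : MvPolynomial (Fin n) ℝ} {k : ℕ} (hp : p.IsHomogeneous k)
    (r : ℝ) (x : E n) :
    eval (fun i ↦ (r • x) i) p = r ^ k * eval (fun i ↦ x i) p := by
  simp only [eval_eq, PiLp.smul_apply, smul_eq_mul, mul_pow, Finset.prod_mul_distrib,
    Finset.prod_pow_eq_pow_sum, Finset.mul_sum]
  refine Finset.sum_congr rfl fun s hs ↦ ?_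
  rw [← hp.degree_eq_sum_deg_support hs]
  ring

def gaussianIntegral (p : MvPolynomial (Fin n) ℝ) : ℝ :=
  ∫ x : E n, eval (fun i ↦ x i) p * Real.exp (-‖x‖ ^ 2)

variable [NeZero n]

theorem integrable_eval_mul_exp_neg_norm_sq (p : MvPolynomial (Fin n) ℝ) :
    Integrable fun x : E n ↦ eval (fun i ↦ x i) p * Real.exp (-‖x‖ ^ 2) := by
  rw [← sum_homogeneousComponent p]
  simp only [map_sum, Finset.sum_mul]
  exact integrable_finsetSum _ fun k _ ↦
    integrable_mul_exp_neg_norm_sq_of_homogeneous volume (continuous_eval_euclidean _)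
      (eval_smul_of_isHomogeneous (homogeneousComponent_isHomogeneous k p))

theorem gaussianIntegral_sum {ι : Type*} (s : Finset ι) (p : ι → MvPolynomial (Fin n) ℝ) :
    gaussianIntegral (∑ i ∈ s, p i) = ∑ i ∈ s, gaussianIntegral (p i) := by
  simp only [gaussianIntegral, map_sum, Finset.sum_mul]
  exact integral_finsetSum _ fun i _ ↦ integrable_eval_mul_exp_neg_norm_sq (p i)

theorem gaussianIntegral_add (p q : MvPolynomial (Fin n) ℝ) :
    gaussianIntegral (p + q) = gaussianIntegral p + gaussianIntegral q := by
  simp only [gaussianIntegral, map_add, add_mul]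
  exact integral_add (integrable_eval_mul_exp_neg_norm_sq p) (integrable_eval_mul_exp_neg_norm_sq q)

theorem gaussianIntegral_pderiv (i : Fin n) (p : MvPolynomial (Fin n) ℝ) :
    gaussianIntegral (pderiv i p) = 2 * gaussianIntegral (X i * p) := by
  have hexp (x : E n) : HasFDerivAt (fun x : E n ↦ Real.exp (-‖x‖ ^ 2))
      (Real.exp (-‖x‖ ^ 2) • -((2 : ℕ) • (innerSL ℝ x : E n →L[ℝ] ℝ))) x :=
    (hasStrictFDerivAt_norm_sq x).hasFDerivAt.neg.exp
  have hexp' (x : E n) : fderiv ℝ (fun x : E n ↦ Real.exp (-‖x‖ ^ 2)) x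
      (EuclideanSpace.single i 1) = -2 * (x i * Real.exp (-‖x‖ ^ 2)) := by
    simp [(hexp x).fderiv, EuclideanSpace.inner_single_right]
    ring
  have hpd (x : E n) := congrFun (pd_eval i p) x
  simp only [pd] at hpd
  have hX : Integrable fun x : E n ↦
      eval (fun i ↦ x i) p * (-2 * (x i * Real.exp (-‖x‖ ^ 2))) := by
    convert! (integrable_eval_mul_exp_neg_norm_sq (X i * p)).const_mul (-2) using 2 with x
    simp
    ring
  have h := integral_mul_fderiv_eq_neg_fderiv_mul_of_integrable (μ := volume)
    (f := fun x : E n ↦ eval (fun i ↦ x i) p) (g := fun x : E n ↦ Real.exp (-‖x‖ ^ 2))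
    (v := EuclideanSpace.single i 1)
    (by simpa only [hpd] using integrable_eval_mul_exp_neg_norm_sq (pderiv i p))
    (by simpa only [hexp'] using hX) (integrable_eval_mul_exp_neg_norm_sq p)
    (fun x _ ↦ (hasFDerivAt_eval p x).differentiableAt) (fun x _ ↦ (hexp x).differentiableAt)
  simp only [hpd, hexp'] at h
  rw [gaussianIntegral, gaussianIntegral, ← neg_eq_iff_eq_neg.2 h, ← integral_neg,
    ← integral_const_mul]
  congr 1 with x
  simp
  ring

theorem gaussianIntegral_eq_of_isHomogeneous {p : MvPolynomial (Fin n) ℝ} {k : ℕ}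
    (hp : p.IsHomogeneous k) :
    gaussianIntegral p =
      (∫ y : sphere (0 : E n) 1, eval (fun i ↦ (y : E n) i) p ∂(volume : Measure (E n)).toSphere) *
        (1 / 2 * Real.Gamma ((k + n) / 2)) := by
  have h := integral_mul_exp_neg_norm_sq_of_homogeneous (V := E n) (k := k)
    (f := fun x ↦ eval (fun i ↦ x i) p) volume (fun r x ↦ eval_smul_of_isHomogeneous hp r x)
  rwa [finrank_euclideanSpace_fin] at h

theorem sum_gaussianIntegral_pderiv_mul_pderiv {p q : MvPolynomial (Fin n) ℝ} {d : ℕ}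
    (hq : q.IsHomogeneous d) (hharm : ∑ i, pderiv i (pderiv i q) = 0) :
    ∑ i, gaussianIntegral (pderiv i p * pderiv i q) = 2 * d * gaussianIntegral (p * q) := by
  have key : ∑ i, gaussianIntegral (pderiv i (p * pderiv i q)) =
      2 * gaussianIntegral (p * (d • q)) := by
    rw [← hq.sum_X_mul_pderiv, Finset.mul_sum, gaussianIntegral_sum, Finset.mul_sum]
    exact Finset.sum_congr rfl fun i _ ↦ by rw [gaussianIntegral_pderiv, mul_left_comm]
  rw [← gaussianIntegral_sum] at key ⊢
  simp only [pderiv_mul, Finset.sum_add_distrib, ← Finset.mul_sum, hharm, mul_zero, add_zero] at key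
  rw [key, mul_assoc]
  simp [gaussianIntegral, ← integral_const_mul, mul_left_comm, mul_assoc]

theorem sum_integral_sphere_pderiv_mul_pderiv {p q : MvPolynomial (Fin n) ℝ} {d : ℕ}
    (hd : 1 ≤ d) (hp : p.IsHomogeneous d) (hq : q.IsHomogeneous d)
    (hharm : ∑ i, pderiv i (pderiv i q) = 0) :
    ∑ i, ∫ y : sphere (0 : E n) 1, eval (fun j ↦ (y : E n) j) (pderiv i p * pderiv i q)
        ∂(volume : Measure (E n)).toSphere =
      d * (2 * d + n - 2) * ∫ y : sphere (0 : E n) 1, eval (fun j ↦ (y : E n) j) (p * q)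
        ∂(volume : Measure (E n)).toSphere := by
  obtain ⟨e, rfl⟩ := Nat.exists_eq_add_of_le' hd
  have h := sum_gaussianIntegral_pderiv_mul_pderiv (p := p) hq hharm
  have hn : (0 : ℝ) < n := Nat.cast_pos.2 (NeZero.pos n)
  have hpos : (0 : ℝ) < ((e + e : ℕ) + n) / 2 := by positivity
  have hΓ := Real.Gamma_pos_of_pos hpos
  rw [gaussianIntegral_eq_of_isHomogeneous (hp.mul hq),
    Finset.sum_congr rfl fun i _ ↦
      gaussianIntegral_eq_of_isHomogeneous (hp.pderiv (i := i) |>.mul (hq.pderiv (i := i))),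
    ← Finset.sum_mul, Nat.add_sub_cancel,
    show (((e + 1 + (e + 1) : ℕ) : ℝ) + n) / 2 = ((e + e : ℕ) + n) / 2 + 1 by push_cast; ring,
    Real.Gamma_add_one hpos.ne'] at h
  refine mul_right_cancel₀ (mul_pos one_half_pos hΓ).ne' (h.trans ?_)
  push_cast
  ring

end Polynomial

theorem stmt0 (n d : ℕ) (hn : 2 ≤ n) (hd : 1 ≤ d)
    (P Q : E n → ℝ) (hP : IsHHP n d P) (hQ : IsHHP n d Q) :
    sInner n P Q =
      (1 / ((d : ℝ) * (2 * d + n - 2))) * ∑ i : Fin n, sInner n (pd n i P) (pd n i Q) := by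
  obtain ⟨⟨p, hp, hPp⟩, -⟩ := hP
  obtain ⟨⟨q, hq, hQq⟩, hharm⟩ := hQ
  obtain rfl : P = fun x ↦ MvPolynomial.eval (fun i ↦ x i) p := funext hPp
  obtain rfl : Q = fun x ↦ MvPolynomial.eval (fun i ↦ x i) q := funext hQq
  have : NeZero n := ⟨by omega⟩
  have hq0 : ∑ i, MvPolynomial.pderiv i (MvPolynomial.pderiv i q) = 0 := MvPolynomial.funext fun x ↦ by
    simpa [lap_eval] using hharm (WithLp.toLp 2 x)
  have h := sum_integral_sphere_pderiv_mul_pderiv hd hp hq hq0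
  have hn' : (2 : ℝ) ≤ n := by exact_mod_cast hn
  have hd' : (1 : ℝ) ≤ d := by exact_mod_cast hd
  have hne : (d * 2 + n - 2 : ℝ) ≠ 0 := by linarith
  simp only [sInner, sAvg, pd_eval, average_eq, ← map_mul, smul_eq_mul, ← Finset.mul_sum, h]
  field_simp
end
end

section
/- The map K : 𝒫_{d-1} → 𝒫_d defined by K[p] = x₁ p − (1/(2d+n−4)) |x|² ∂₁p is a linear isomorphism onto the orthogonal complement (in L²(∂B(0,1))) of the subspace of x₁-invariant homogeneous harmonic polynomials of degree d, and satisfies ‖K[p]‖ ≤ ‖x₁ p‖_{L²(∂B(0,1))} ≤ ‖p‖. -/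
open MeasureTheory Metric

noncomputable section

noncomputable def lapPoly (n : ℕ) : MvPolynomial (Fin n) ℝ →ₗ[ℝ] MvPolynomial (Fin n) ℝ :=
  ∑ i : Fin n, ((MvPolynomial.pderiv i).toLinearMap.comp (MvPolynomial.pderiv i).toLinearMap)

noncomputable def hhpSub (n d : ℕ) : Submodule ℝ (MvPolynomial (Fin n) ℝ) :=
  MvPolynomial.homogeneousSubmodule (Fin n) ℝ d ⊓ LinearMap.ker (lapPoly n)

/-- evaluation of a polynomial as a function on `ℝⁿ` -/
noncomputable def pev (n : ℕ) (p : MvPolynomial (Fin n) ℝ) : E n → ℝ :=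
  fun x => MvPolynomial.eval (fun i => x i) p

lemma integral_mul_comp_norm_eq {n : ℕ} (hn : 2 ≤ n) {f : E n → ℝ} {m : ℕ}
    (hf : ∀ (r : ℝ) (x : E n), f (r • x) = r ^ m * f x) (ρ : ℝ → ℝ) :
    ∫ x, f x * ρ ‖x‖ =
      (∫ y : sphere (0 : E n) 1, f y ∂((volume : Measure (E n)).toSphere)) *
        ∫ r in Set.Ioi (0 : ℝ), r ^ (n - 1) * (r ^ m * ρ r) := by
  have : Nontrivial (E n) := by
    have : Nonempty (Fin n) := ⟨⟨0, by omega⟩⟩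
    infer_instance
  have hdim : Module.finrank ℝ (E n) = n := by simp
  calc
    ∫ x, f x * ρ ‖x‖ = ∫ x : ({(0)}ᶜ : Set (E n)), f x.1 * ρ ‖x.1‖ ∂(volume.comap Subtype.val) := by
      rw [integral_subtype_comap (measurableSet_singleton _).compl (fun x : E n ↦ f x * ρ ‖x‖),
        restrict_compl_singleton]
    _ = ∫ x : ↥(sphere (0 : E n) 1) × ↥(Set.Ioi (0 : ℝ)), f (x.1 : E n) * (x.2.1 ^ m * ρ x.2.1)
          ∂(volume : Measure (E n)).toSphere.prod
            (.volumeIoiPow (Module.finrank ℝ (E n) - 1)) := by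
      rw [← (volume : Measure (E n)).measurePreserving_homeomorphUnitSphereProd.integral_comp
        (Homeomorph.measurableEmbedding _)]
      refine integral_congr_ae (.of_forall fun x => ?_)
      have hx : x.1 = ‖x.1‖ • (‖x.1‖⁻¹ • x.1) := by
        rw [smul_smul, mul_inv_cancel₀ (norm_ne_zero_iff.2 x.2), one_smul]
      simp only [homeomorphUnitSphereProd_apply_snd_coe, homeomorphUnitSphereProd_apply_fst_coe]
      conv_lhs => rw [hx, hf, ← hx]
      ring
    _ = (∫ y : sphere (0 : E n) 1, f y ∂((volume : Measure (E n)).toSphere)) *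
          ∫ r : Set.Ioi (0 : ℝ), r.1 ^ m * ρ r.1 ∂.volumeIoiPow (n - 1) := by
      rw [hdim]
      exact integral_prod_mul (fun y : sphere (0 : E n) 1 => f y)
        (fun r : Set.Ioi (0 : ℝ) => r.1 ^ m * ρ r.1)
    _ = _ := by
      congr 1
      simp only [Measure.volumeIoiPow, ENNReal.ofReal]
      rw [integral_withDensity_eq_integral_smul,
        integral_subtype_comap measurableSet_Ioi
          fun a : ℝ ↦ Real.toNNReal (a ^ (n - 1)) • (a ^ m * ρ a),
        setIntegral_congr_fun measurableSet_Ioi fun x hx ↦ ?_]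
      · rw [NNReal.smul_def, Real.coe_toNNReal _ (pow_nonneg (le_of_lt hx) _), smul_eq_mul]
      · exact (measurable_subtype_coe.pow_const _).real_toNNReal

lemma hasFDerivAt_pev {n : ℕ} (p : MvPolynomial (Fin n) ℝ) (x : E n) :
    HasFDerivAt (pev n p)
      (∑ i, pev n (MvPolynomial.pderiv i p) x • (EuclideanSpace.proj i : E n →L[ℝ] ℝ)) x := by
  induction p using MvPolynomial.induction_on with
  | C a =>
    have h : pev n (MvPolynomial.C a) = fun _ => a := by ext; simp [pev]
    simpa [h, pev, MvPolynomial.pderiv_C] using hasFDerivAt_const (𝕜 := ℝ) a x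
  | add p q hp hq =>
    convert! hp.add hq using 1
    · ext y; simp [pev]
    · simp [pev, add_smul, Finset.sum_add_distrib]
  | mul_X p j hp =>
    convert! hp.mul (EuclideanSpace.proj j : E n →L[ℝ] ℝ).hasFDerivAt using 1
    · ext y; simp [pev]
    · ext v
      simp [pev, Pi.single_apply, add_mul, Finset.sum_add_distrib, Finset.mul_sum,
        MvPolynomial.pderiv_X, apply_ite]
      congr 1
      exact funext fun i => by ring

lemma continuous_pev {n : ℕ} (p : MvPolynomial (Fin n) ℝ) : Continuous (pev n p) :=
  continuous_iff_continuousAt.2 fun x => (hasFDerivAt_pev p x).continuousAt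

lemma pev_smul {n m : ℕ} {p : MvPolynomial (Fin n) ℝ} (hp : p.IsHomogeneous m) (r : ℝ) (x : E n) :
    pev n p (r • x) = r ^ m * pev n p x := by
  simp only [pev, MvPolynomial.eval_eq', Finset.mul_sum]
  refine Finset.sum_congr rfl fun s hs => ?_
  have hs' : ∑ i, s i = m := by
    rw [← Finsupp.degree_eq_sum, Finsupp.degree_eq_weight_one (R := ℕ)]
    exact hp (MvPolynomial.mem_support_iff.1 hs)
  simp only [PiLp.smul_apply, smul_eq_mul, mul_pow, Finset.prod_mul_distrib,
    Finset.prod_pow_eq_pow_sum, hs']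
  ring

lemma integral_pderiv_mul_comp_norm_sq {n : ℕ} (g : MvPolynomial (Fin n) ℝ) (i : Fin n)
    {φ : ℝ → ℝ} (hφ : ContDiff ℝ 1 φ) (hφ' : ∀ t, 1 ≤ t → φ t = 0) :
    ∫ x, pev n (MvPolynomial.pderiv i g) x * φ (‖x‖ ^ 2) =
      -(2 * ∫ x, pev n (MvPolynomial.X i * g) x * deriv φ (‖x‖ ^ 2)) := by
  have hd (x : E n) : HasFDerivAt (fun x : E n => φ (‖x‖ ^ 2))
      (deriv φ (‖x‖ ^ 2) • (2 • innerSL ℝ x)) x :=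
    ((hφ.differentiable (by norm_num) _).hasDerivAt).comp_hasFDerivAt x
      (hasStrictFDerivAt_norm_sq x).hasFDerivAt
  have hder : ∀ t, 1 < t → deriv φ t = 0 := fun t ht => by
    have : φ =ᶠ[nhds t] fun _ => 0 := by
      filter_upwards [lt_mem_nhds ht] with s hs using hφ' s hs.le
    rw [this.deriv_eq, deriv_const]
  have hint {f : E n → ℝ} (hf : Continuous f) {ψ : ℝ → ℝ} (hψ : Continuous ψ)
      (h : ∀ t, 1 < t → ψ t = 0) : Integrable (fun x => f x * ψ (‖x‖ ^ 2)) := by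
    refine Continuous.integrable_of_hasCompactSupport (by fun_prop) ?_
    refine HasCompactSupport.intro (isCompact_closedBall (0 : E n) 1) fun x hx => ?_
    rw [mem_closedBall_zero_iff, not_le] at hx
    rw [h _ (one_lt_pow₀ hx two_ne_zero), mul_zero]
  have hX (x : E n) : fderiv ℝ (fun x : E n => φ (‖x‖ ^ 2)) x (EuclideanSpace.single i 1) =
      2 * x i * deriv φ (‖x‖ ^ 2) := by
    rw [(hd x).fderiv]
    simp [EuclideanSpace.inner_single_right]
    ring
  have hg (x : E n) : fderiv ℝ (pev n g) x (EuclideanSpace.single i 1) =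
      pev n (MvPolynomial.pderiv i g) x := by
    rw [(hasFDerivAt_pev g x).fderiv]
    simp
  have hc := hφ.continuous_deriv le_rfl
  have hcg := continuous_pev g
  have key := integral_mul_fderiv_eq_neg_fderiv_mul_of_integrable (μ := (volume : Measure (E n)))
    (f := pev n g) (g := fun x : E n => φ (‖x‖ ^ 2)) (v := EuclideanSpace.single i 1)
    (by simpa only [hg] using hint (continuous_pev _) hφ.continuous fun t ht => hφ' t ht.le)
    (by
      simp only [hX, ← mul_assoc]
      exact hint (f := fun x => pev n g x * 2 * x i) (by fun_prop) hc hder)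
    (hint hcg hφ.continuous fun t ht => hφ' t ht.le)
    (fun x _ => (hasFDerivAt_pev g x).differentiableAt)
    (fun x _ => (hd x).differentiableAt)
  simp only [hX, hg] at key
  rw [← integral_const_mul, ← neg_eq_iff_eq_neg, ← key]
  refine integral_congr_ae (.of_forall fun x => ?_)
  simp only [pev, map_mul, MvPolynomial.eval_X]
  ring

lemma integral_Ioi_pow_mul_comp_sq {φ : ℝ → ℝ} (hφ : ContDiff ℝ 1 φ)
    (hφ' : ∀ t, 1 ≤ t → φ t = 0) (k : ℕ) :
    (k + 1 : ℝ) * ∫ r in Set.Ioi (0 : ℝ), r ^ k * φ (r ^ 2) =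
      -(2 * ∫ r in Set.Ioi (0 : ℝ), r ^ (k + 2) * deriv φ (r ^ 2)) := by
  have hder : ∀ t, 1 < t → deriv φ t = 0 := fun t ht => by
    have : φ =ᶠ[nhds t] fun _ => 0 := by
      filter_upwards [lt_mem_nhds ht] with s hs using hφ' s hs.le
    rw [this.deriv_eq, deriv_const]
  have hc := hφ.continuous_deriv le_rfl
  have hc' := hφ.continuous
  have hint {ψ : ℝ → ℝ} (hψ : Continuous ψ) (h : ∀ t, 1 < t → ψ t = 0) (m : ℕ) :
      IntegrableOn (fun r : ℝ => r ^ m * ψ (r ^ 2)) (Set.Ioi 0) := by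
    refine (Continuous.integrable_of_hasCompactSupport (by fun_prop) ?_).integrableOn
    refine HasCompactSupport.intro (isCompact_closedBall (0 : ℝ) 1) fun x hx => ?_
    rw [mem_closedBall_zero_iff, not_le, Real.norm_eq_abs] at hx
    rw [h _ (by rw [← sq_abs]; exact one_lt_pow₀ hx two_ne_zero), mul_zero]
  have hd (r : ℝ) : HasDerivAt (fun r : ℝ => r ^ (k + 1) * φ (r ^ 2))
      ((k + 1 : ℝ) * (r ^ k * φ (r ^ 2)) + 2 * (r ^ (k + 2) * deriv φ (r ^ 2))) r := by
    have h1 := (hasDerivAt_pow (k + 1) r).mul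
      (((hφ.differentiable (by norm_num) _).hasDerivAt).comp r (hasDerivAt_pow 2 r))
    convert! h1 using 1
    simp
    ring
  have hi1 := (hint hc' (fun t ht => hφ' t ht.le) k).const_mul (k + 1 : ℝ)
  have hi2 := (hint hc hder (k + 2)).const_mul 2
  have h := integral_Ioi_of_hasDerivAt_of_tendsto' (a := (0 : ℝ)) (m := 0) (fun r _ => hd r)
    (hi1.add hi2) (by
      refine tendsto_const_nhds.congr' ?_
      filter_upwards [Filter.eventually_ge_atTop (1 : ℝ)] with r hr
      rw [hφ' _ (one_le_pow₀ hr), mul_zero])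
  rw [integral_add hi1 hi2, integral_const_mul, integral_const_mul] at h
  simp at h
  linarith

lemma pderiv_eq_zero_of_isHomogeneous_zero {σ : Type*} {p : MvPolynomial σ ℝ}
    (hp : p.IsHomogeneous 0) (i : σ) : MvPolynomial.pderiv i p = 0 := by
  rw [MvPolynomial.totalDegree_eq_zero_iff_eq_C.1 (Nat.le_zero.1 hp.totalDegree_le),
    MvPolynomial.pderiv_C]

lemma integral_sphere_pderiv {n : ℕ} (hn : 2 ≤ n) {g : MvPolynomial (Fin n) ℝ} {k : ℕ}
    (hg : g.IsHomogeneous k) (i : Fin n) :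
    ∫ y : sphere (0 : E n) 1, pev n (MvPolynomial.pderiv i g) y
        ∂((volume : Measure (E n)).toSphere) =
      (k + n - 1 : ℝ) * ∫ y : sphere (0 : E n) 1, pev n (MvPolynomial.X i * g) y
        ∂((volume : Measure (E n)).toSphere) := by
  set φ : ℝ → ℝ := fun t => expNegInvGlue (1 - t) with hφdef
  have hφ : ContDiff ℝ 1 φ := (expNegInvGlue.contDiff (n := 1)).comp (contDiff_const.sub contDiff_id)
  have hφ' : ∀ t, 1 ≤ t → φ t = 0 := fun t ht => expNegInvGlue.zero_of_nonpos (by linarith)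
  have h := integral_pderiv_mul_comp_norm_sq g i hφ hφ'
  have h2 : (MvPolynomial.X i * g).IsHomogeneous (1 + k) := (MvPolynomial.isHomogeneous_X ℝ i).mul hg
  rw [integral_mul_comp_norm_eq hn (pev_smul hg.pderiv) (fun r => φ (r ^ 2)),
    integral_mul_comp_norm_eq hn (pev_smul h2) (fun r => deriv φ (r ^ 2))] at h
  have h3 := integral_Ioi_pow_mul_comp_sq hφ hφ' (n - 2 + k)
  have hcast : ((n - 2 + k : ℕ) : ℝ) + 1 = k + n - 1 := by
    rw [Nat.cast_add, Nat.cast_sub (by omega)]; push_cast; ring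
  simp only [← mul_assoc, ← pow_add] at h
  rw [hcast] at h3
  rw [show n - 1 + (1 + k) = n - 2 + k + 2 by omega] at h
  have hpos : 0 < ∫ r in Set.Ioi (0 : ℝ), r ^ (n - 2 + k) * φ (r ^ 2) := by
    have hc := hφ.continuous
    have hcont : Continuous fun r : ℝ => r ^ (n - 2 + k) * φ (r ^ 2) := by fun_prop
    rw [setIntegral_pos_iff_support_of_nonneg_ae]
    · refine lt_of_lt_of_le (b := volume (Set.Ioo (0 : ℝ) 1)) (by simp) (measure_mono ?_)
      intro r hr
      refine ⟨?_, hr.1⟩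
      have : 0 < φ (r ^ 2) := expNegInvGlue.pos_of_pos (by nlinarith [hr.1, hr.2])
      exact (mul_pos (pow_pos hr.1 _) this).ne'
    · filter_upwards [ae_restrict_mem measurableSet_Ioi] with r hr
      exact mul_nonneg (pow_nonneg (le_of_lt hr) _) (expNegInvGlue.nonneg _)
    · refine (Continuous.integrable_of_hasCompactSupport hcont ?_).integrableOn
      refine HasCompactSupport.intro (isCompact_closedBall (0 : ℝ) 1) fun x hx => ?_
      rw [mem_closedBall_zero_iff, not_le, Real.norm_eq_abs] at hx
      rw [hφ' _ (by rw [← sq_abs]; exact (one_lt_pow₀ hx two_ne_zero).le), mul_zero]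
  have h4 : (∫ y : sphere (0 : E n) 1, pev n (MvPolynomial.pderiv i g) y
        ∂((volume : Measure (E n)).toSphere)) *
      ∫ r in Set.Ioi (0 : ℝ), r ^ (n - 1 + (k - 1)) * φ (r ^ 2) =
      (∫ y : sphere (0 : E n) 1, pev n (MvPolynomial.pderiv i g) y
        ∂((volume : Measure (E n)).toSphere)) *
      ∫ r in Set.Ioi (0 : ℝ), r ^ (n - 2 + k) * φ (r ^ 2) := by
    rcases k.eq_zero_or_pos with rfl | hk
    · rw [pderiv_eq_zero_of_isHomogeneous_zero hg]
      simp [pev]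
    · rw [show n - 1 + (k - 1) = n - 2 + k by omega]
  refine mul_right_cancel₀ hpos.ne' ?_
  rw [← h4, h]
  linear_combination (-(∫ y : sphere (0 : E n) 1, pev n (MvPolynomial.X i * g) y
        ∂((volume : Measure (E n)).toSphere))) * h3

lemma integrable_pev_sphere {n : ℕ} (p : MvPolynomial (Fin n) ℝ) :
    Integrable (fun y : sphere (0 : E n) 1 => pev n p y)
      ((volume : Measure (E n)).toSphere) := by
  have h := continuous_pev p
  refine Continuous.integrable_of_hasCompactSupport (by fun_prop) ?_
  exact HasCompactSupport.of_compactSpace _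

/-- The normalized spherical average as a linear functional on polynomials. -/
def sphereAvg (n : ℕ) : MvPolynomial (Fin n) ℝ →ₗ[ℝ] ℝ where
  toFun p := sAvg n (pev n p)
  map_add' p q := by
    have h : pev n (p + q) = fun x => pev n p x + pev n q x := by ext; simp [pev]
    simp only [sAvg, average_eq, h]
    rw [integral_add (integrable_pev_sphere p) (integrable_pev_sphere q), smul_add]
  map_smul' c p := by
    have h : pev n (c • p) = fun x => c * pev n p x := by ext; simp [pev]
    simp only [sAvg, average_eq, h, integral_const_mul, smul_eq_mul, RingHom.id_apply]
    ring

lemma pev_mul {n : ℕ} (p q : MvPolynomial (Fin n) ℝ) :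
    pev n (p * q) = fun x => pev n p x * pev n q x := by
  ext
  simp [pev]

lemma sInner_pev {n : ℕ} (p q : MvPolynomial (Fin n) ℝ) :
    sInner n (pev n p) (pev n q) = sphereAvg n (p * q) := by
  simp [sInner, sphereAvg, pev_mul]

lemma sNorm_pev {n : ℕ} (p : MvPolynomial (Fin n) ℝ) :
    sNorm n (pev n p) = √(sphereAvg n (p * p)) := by
  simp [sNorm, sphereAvg, pev_mul, sq]

lemma sphereAvg_pderiv {n : ℕ} (hn : 2 ≤ n) {g : MvPolynomial (Fin n) ℝ} {k : ℕ}
    (hg : g.IsHomogeneous k) (i : Fin n) :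
    sphereAvg n (MvPolynomial.pderiv i g) =
      (k + n - 1 : ℝ) * sphereAvg n (MvPolynomial.X i * g) := by
  simp only [sphereAvg, sAvg, LinearMap.coe_mk, AddHom.coe_mk, average_eq, smul_eq_mul,
    integral_sphere_pderiv hn hg]
  ring

lemma sphereAvg_sum_sq_mul {n : ℕ} (p : MvPolynomial (Fin n) ℝ) :
    sphereAvg n ((∑ i, MvPolynomial.X i ^ 2) * p) = sphereAvg n p := by
  simp only [sphereAvg, sAvg, LinearMap.coe_mk, AddHom.coe_mk, average_eq]
  congr 1
  refine integral_congr_ae (.of_forall fun y => ?_)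
  have hy : ∑ i, (y : E n) i ^ 2 = 1 := by
    rw [← EuclideanSpace.real_norm_sq_eq, norm_eq_of_mem_sphere, one_pow]
  simp [pev, hy]

lemma sphereAvg_mul_self_nonneg {n : ℕ} (p : MvPolynomial (Fin n) ℝ) :
    0 ≤ sphereAvg n (p * p) := by
  simp only [sphereAvg, sAvg, LinearMap.coe_mk, AddHom.coe_mk, average_eq]
  refine smul_nonneg (by positivity) (integral_nonneg fun y => ?_)
  simpa [pev] using mul_self_nonneg _

lemma eq_zero_of_sphereAvg_mul_self {n m : ℕ} (hn : 2 ≤ n) {p : MvPolynomial (Fin n) ℝ}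
    (hp : p.IsHomogeneous m) (h : sphereAvg n (p * p) = 0) : p = 0 := by
  have : Nontrivial (E n) := by
    have : Nonempty (Fin n) := ⟨⟨0, by omega⟩⟩
    infer_instance
  have hμ : ((volume : Measure (E n)).toSphere).real Set.univ ≠ 0 := by
    rw [measureReal_ne_zero_iff, Measure.measure_univ_ne_zero]
    exact Measure.toSphere_ne_zero _
  have hc := continuous_pev p
  have h0 : ∀ y : sphere (0 : E n) 1, pev n p y = 0 := by
    simp only [sphereAvg, sAvg, LinearMap.coe_mk, AddHom.coe_mk, average_eq, smul_eq_mul,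
      mul_eq_zero, inv_eq_zero, hμ, false_or] at h
    have hsq : (fun y : sphere (0 : E n) 1 => pev n (p * p) y) =
        fun y : sphere (0 : E n) 1 => pev n p y ^ 2 := by
      ext y; simp [pev, sq]
    have hi := integrable_pev_sphere (p * p)
    rw [hsq] at h hi
    rw [integral_eq_zero_iff_of_nonneg (fun y => sq_nonneg _) hi] at h
    have h' := (Continuous.ae_eq_iff_eq _ ((hc.comp continuous_subtype_val).pow 2)
      continuous_const).1 h
    intro y
    exact pow_eq_zero_iff two_ne_zero |>.1 (congrFun h' y)
  refine MvPolynomial.funext_set (fun _ => Set.Ioi 0) (fun _ => Set.Ioi_infinite 0) fun x hx => ?_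
  set y : E n := WithLp.toLp 2 x with hy
  have hy0 : y ≠ 0 := fun h => by
    have h1 : y ⟨0, by omega⟩ = 0 := by rw [h]; rfl
    exact (hx ⟨0, by omega⟩ trivial).ne' h1
  have hnorm : ‖y‖ ≠ 0 := norm_ne_zero_iff.2 hy0
  have h1 := h0 ⟨‖y‖⁻¹ • y, by simp [norm_smul, hnorm]⟩
  have h2 := pev_smul hp ‖y‖ (‖y‖⁻¹ • y)
  rw [h1, smul_smul, mul_inv_cancel₀ hnorm, one_smul, mul_zero] at h2
  simpa [pev, hy] using h2

open MvPolynomial in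
lemma pderiv_comm {σ : Type*} {R : Type*} [CommRing R] (i j : σ) (p : MvPolynomial σ R) :
    pderiv i (pderiv j p) = pderiv j (pderiv i p) := by
  classical
  have h : ⁅(pderiv i : Derivation R (MvPolynomial σ R) (MvPolynomial σ R)),
      (pderiv j : Derivation R (MvPolynomial σ R) (MvPolynomial σ R))⁆ = 0 := by
    refine MvPolynomial.derivation_ext fun k => ?_
    simp only [Derivation.commutator_apply, pderiv_X, Pi.single_apply, Derivation.zero_apply]
    split_ifs <;> simp
  have := congrArg (fun D : Derivation R (MvPolynomial σ R) (MvPolynomial σ R) => D p) h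
  simpa [Derivation.commutator_apply, sub_eq_zero] using this

section Harmonic

open MvPolynomial

variable {n : ℕ}

lemma mem_hhpSub {d : ℕ} {p : MvPolynomial (Fin n) ℝ} :
    p ∈ hhpSub n d ↔ p.IsHomogeneous d ∧ lapPoly n p = 0 := by
  simp [hhpSub]

lemma lapPoly_apply (p : MvPolynomial (Fin n) ℝ) :
    lapPoly n p = ∑ i, pderiv i (pderiv i p) := by
  simp [lapPoly]

lemma lapPoly_mul (p q : MvPolynomial (Fin n) ℝ) :
    lapPoly n (p * q) =
      lapPoly n p * q + 2 * ∑ i, pderiv i p * pderiv i q + p * lapPoly n q := by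
  simp only [lapPoly_apply, pderiv_mul, map_add, Finset.sum_mul, Finset.mul_sum,
    ← Finset.sum_add_distrib]
  exact Finset.sum_congr rfl fun i _ => by ring

lemma lapPoly_X_mul (e : Fin n) (p : MvPolynomial (Fin n) ℝ) :
    lapPoly n (X e * p) = 2 * pderiv e p + X e * lapPoly n p := by
  have h : lapPoly n (X e) = 0 := by
    rw [lapPoly_apply]
    refine Finset.sum_eq_zero fun i _ => ?_
    rw [pderiv_X]
    by_cases h : e = i <;> simp [h]
  rw [lapPoly_mul, h]
  simp [pderiv_X, Pi.single_apply]

lemma pderiv_sum_sq (i : Fin n) :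
    pderiv i (∑ j, X j ^ 2 : MvPolynomial (Fin n) ℝ) = 2 * X i := by
  simp [pderiv_X, Pi.single_apply]

lemma lapPoly_sum_sq_mul {k : ℕ} {q : MvPolynomial (Fin n) ℝ} (hq : q.IsHomogeneous k) :
    lapPoly n ((∑ j, X j ^ 2) * q) =
      C (2 * (n : ℝ) + 4 * k) * q + (∑ j, X j ^ 2) * lapPoly n q := by
  have h : lapPoly n (∑ j, X j ^ 2 : MvPolynomial (Fin n) ℝ) = C (2 * (n : ℝ)) := by
    have h2 (i : Fin n) : pderiv i (2 * X i : MvPolynomial (Fin n) ℝ) = 2 := by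
      rw [← map_ofNat C, pderiv_C_mul, pderiv_X_self, mul_one]
    simp only [lapPoly_apply, pderiv_sum_sq, h2]
    simp only [Finset.sum_const, Finset.card_univ, Fintype.card_fin, nsmul_eq_mul, map_mul,
      map_ofNat, map_natCast, mul_comm]
  have h2 : ∑ i, pderiv i (∑ j, X j ^ 2 : MvPolynomial (Fin n) ℝ) * pderiv i q =
      C (2 * (k : ℝ)) * q := by
    have := hq.sum_X_mul_pderiv
    simp only [pderiv_sum_sq, mul_assoc, ← Finset.mul_sum, this]
    simp only [map_mul, map_ofNat, map_natCast, nsmul_eq_mul, mul_assoc]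
  rw [lapPoly_mul, h, h2]
  simp only [map_add, map_mul, map_ofNat]
  ring

lemma pderiv_mem_hhpSub {d : ℕ} {p : MvPolynomial (Fin n) ℝ} (hp : p ∈ hhpSub n d) (e : Fin n) :
    pderiv e p ∈ hhpSub n (d - 1) := by
  rw [mem_hhpSub] at hp ⊢
  refine ⟨hp.1.pderiv, ?_⟩
  have h := congrArg (pderiv e) hp.2
  rw [lapPoly_apply, map_sum, map_zero] at h
  rw [lapPoly_apply, ← h]
  exact Finset.sum_congr rfl fun i _ => by rw [pderiv_comm e i, pderiv_comm e i]

lemma X_mul_mem_hhpSub {d : ℕ} {q : MvPolynomial (Fin n) ℝ} (hq : q ∈ hhpSub n d) {e : Fin n}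
    (he : pderiv e q = 0) : X e * q ∈ hhpSub n (1 + d) := by
  rw [mem_hhpSub] at hq ⊢
  exact ⟨(isHomogeneous_X ℝ e).mul hq.1, by rw [lapPoly_X_mul, he, hq.2]; simp⟩

lemma sphereAvg_C_mul (c : ℝ) (p : MvPolynomial (Fin n) ℝ) :
    sphereAvg n (C c * p) = c * sphereAvg n p := by
  rw [← smul_eq_C_mul, map_smul, smul_eq_mul]

lemma degree_mul_sphereAvg_mul (hn : 2 ≤ n) {a b : ℕ} {p q : MvPolynomial (Fin n) ℝ}
    (hp : p ∈ hhpSub n a) (hq : q.IsHomogeneous b) :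
    (a + b + n - 2 : ℝ) * (a * sphereAvg n (p * q)) =
      ∑ i, sphereAvg n (pderiv i p * pderiv i q) := by
  rw [mem_hhpSub] at hp
  have hE : (a : ℝ) * sphereAvg n (p * q) = ∑ i, sphereAvg n (X i * (pderiv i p * q)) := by
    rw [← map_sum, ← sphereAvg_C_mul]
    simp only [← mul_assoc, ← Finset.sum_mul, hp.1.sum_X_mul_pderiv]
    simp
  have hi (i : Fin n) : (a + b + n - 2 : ℝ) * sphereAvg n (X i * (pderiv i p * q)) =
      sphereAvg n (pderiv i (pderiv i p * q)) := by
    rcases a.eq_zero_or_pos with rfl | ha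
    · simp [pderiv_eq_zero_of_isHomogeneous_zero hp.1]
    · rw [sphereAvg_pderiv hn (hp.1.pderiv.mul hq)]
      push_cast [Nat.cast_sub ha]
      ring
  rw [hE, Finset.mul_sum]
  simp only [hi, pderiv_mul, map_add, Finset.sum_add_distrib]
  rw [← map_sum, ← Finset.sum_mul, ← lapPoly_apply, hp.2]
  simp

lemma sphereAvg_mul_eq_zero (hn : 2 ≤ n) {a b : ℕ} (hab : a ≠ b) {p q : MvPolynomial (Fin n) ℝ}
    (hp : p ∈ hhpSub n a) (hq : q ∈ hhpSub n b) : sphereAvg n (p * q) = 0 := by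
  have h1 := degree_mul_sphereAvg_mul hn hp (mem_hhpSub.1 hq).1
  have h2 := degree_mul_sphereAvg_mul hn hq (mem_hhpSub.1 hp).1
  simp only [mul_comm q, mul_comm (pderiv _ q)] at h2
  have hab' : (a : ℝ) - b ≠ 0 := sub_ne_zero.2 (Nat.cast_injective.ne hab)
  have hpos : (a + b + n - 2 : ℝ) ≠ 0 := by
    have : 1 ≤ a + b := by omega
    have h3 : (1 : ℝ) ≤ a + b := by exact_mod_cast this
    have h4 : (2 : ℝ) ≤ n := by exact_mod_cast hn
    linarith
  have h : (a + b + n - 2 : ℝ) * (a - b) * sphereAvg n (p * q) = 0 := by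
    linear_combination h1 - h2
  simpa [hab', hpos] using h

/-- The harmonic raising operator `p ↦ x_e p - |x|² ∂_e p / (2d + n - 4)`. -/
def raise (n d : ℕ) (e : Fin n) (p : MvPolynomial (Fin n) ℝ) : MvPolynomial (Fin n) ℝ :=
  X e * p - C (1 / (2 * (d : ℝ) + n - 4)) * (∑ i : Fin n, X i ^ 2) * pderiv e p

variable {d : ℕ} {e : Fin n}

lemma raise_add (p q : MvPolynomial (Fin n) ℝ) :
    raise n d e (p + q) = raise n d e p + raise n d e q := by
  simp only [raise, map_add]
  ring

lemma raise_smul (c : ℝ) (p : MvPolynomial (Fin n) ℝ) :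
    raise n d e (c • p) = c • raise n d e p := by
  simp only [raise, smul_eq_C_mul, pderiv_C_mul]
  ring

lemma pderiv_eq_zero_of_mem_hhpSub_zero {p : MvPolynomial (Fin n) ℝ}
    (hp : p ∈ hhpSub n (1 - 1)) : pderiv e p = 0 :=
  pderiv_eq_zero_of_isHomogeneous_zero (mem_hhpSub.1 hp).1 e

lemma raise_mem_hhpSub (hn : 2 ≤ n) (hd : 1 ≤ d) {p : MvPolynomial (Fin n) ℝ}
    (hp : p ∈ hhpSub n (d - 1)) : raise n d e p ∈ hhpSub n d := by
  obtain rfl | hd2 : d = 1 ∨ 2 ≤ d := by omega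
  · simpa [raise, pderiv_eq_zero_of_mem_hhpSub_zero hp] using
      X_mul_mem_hhpSub hp (pderiv_eq_zero_of_mem_hhpSub_zero (e := e) hp)
  have hq := mem_hhpSub.1 (pderiv_mem_hhpSub hp e)
  rw [mem_hhpSub] at hp ⊢
  have hR : (∑ i : Fin n, X i ^ 2 : MvPolynomial (Fin n) ℝ).IsHomogeneous 2 :=
    IsHomogeneous.sum _ _ _ fun i _ => isHomogeneous_X_pow i 2
  constructor
  · have h1 := (isHomogeneous_X ℝ e).mul hp.1
    have h2 := ((isHomogeneous_C (Fin n) (1 / (2 * (d : ℝ) + n - 4))).mul hR).mul hq.1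
    rw [show 1 + (d - 1) = d by omega] at h1
    rw [show 0 + 2 + (d - 1 - 1) = d by omega] at h2
    exact h1.sub h2
  · have hpos : (2 * (d : ℝ) + n - 4) ≠ 0 := by
      have h3 : (2 : ℝ) ≤ d := by exact_mod_cast hd2
      have h4 : (2 : ℝ) ≤ n := by exact_mod_cast hn
      linarith
    rw [raise, map_sub, lapPoly_X_mul, mul_assoc, ← smul_eq_C_mul, map_smul,
      lapPoly_sum_sq_mul hq.1, hp.2, hq.2, smul_eq_C_mul, mul_zero, mul_zero, add_zero, add_zero,
      ← mul_assoc, ← map_mul, sub_eq_zero, ← map_ofNat (C (σ := Fin n) (R := ℝ))]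
    congr 2
    rw [Nat.sub_sub, Nat.cast_sub hd2]
    push_cast
    field_simp
    ring

lemma sphereAvg_raise_mul (hn : 2 ≤ n) (hd : 1 ≤ d) {p h : MvPolynomial (Fin n) ℝ}
    (hp : p ∈ hhpSub n (d - 1)) (hh : h ∈ hhpSub n d) :
    sphereAvg n (raise n d e p * h) = sphereAvg n (X e * p * h) := by
  rw [raise, sub_mul, map_sub, mul_assoc, mul_assoc (C _), mul_assoc (C _), sphereAvg_C_mul,
    mul_assoc (∑ i, X i ^ 2), sphereAvg_sum_sq_mul,
    sphereAvg_mul_eq_zero hn (by omega) (pderiv_mem_hhpSub hp e) hh, mul_zero, sub_zero]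

lemma sphereAvg_pderiv_mul (hn : 2 ≤ n) (hd : 1 ≤ d) {p h : MvPolynomial (Fin n) ℝ}
    (hp : p ∈ hhpSub n (d - 1)) (hh : h ∈ hhpSub n d) :
    sphereAvg n (pderiv e h * p) = (2 * d + n - 2 : ℝ) * sphereAvg n (raise n d e p * h) := by
  have h1 := sphereAvg_pderiv hn ((mem_hhpSub.1 hp).1.mul (mem_hhpSub.1 hh).1) e
  rw [pderiv_mul, map_add,
    sphereAvg_mul_eq_zero hn (by omega) (pderiv_mem_hhpSub hp e) hh, zero_add] at h1
  rw [mul_comm (pderiv e h), h1, sphereAvg_raise_mul hn hd hp hh, mul_assoc]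
  push_cast [Nat.cast_sub hd]
  ring

lemma sphereAvg_raise_mul_eq_zero (hn : 2 ≤ n) (hd : 1 ≤ d) {p q : MvPolynomial (Fin n) ℝ}
    (hp : p ∈ hhpSub n (d - 1)) (hq : q ∈ hhpSub n d) (he : pderiv e q = 0) :
    sphereAvg n (raise n d e p * q) = 0 := by
  rw [sphereAvg_raise_mul hn hd hp hq, mul_comm (X e), mul_assoc]
  exact sphereAvg_mul_eq_zero hn (by omega) hp (X_mul_mem_hhpSub hq he)

lemma eq_zero_of_raise_eq_zero (hn : 2 ≤ n) (hd : 1 ≤ d) {p : MvPolynomial (Fin n) ℝ}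
    (hp : p ∈ hhpSub n (d - 1)) (h : raise n d e p = 0) : p = 0 := by
  obtain rfl | hd2 : d = 1 ∨ 2 ≤ d := by omega
  · simpa [raise, pderiv_eq_zero_of_mem_hhpSub_zero hp, X_ne_zero] using h
  have h3 : (2 : ℝ) ≤ d := by exact_mod_cast hd2
  have h4 : (2 : ℝ) ≤ n := by exact_mod_cast hn
  have hq := pderiv_mem_hhpSub hp e
  set q := pderiv e p with hqdef
  set c : ℝ := 1 / (2 * (d : ℝ) + n - 4) with hc
  have hc0 : 0 ≤ c := by rw [hc]; apply one_div_nonneg.2; linarith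
  have hc1 : c ≤ 1 / 2 := by rw [hc]; apply one_div_le_one_div_of_le <;> linarith
  have hX : X e * p = C c * ((∑ i : Fin n, X i ^ 2) * q) := by
    rw [raise, sub_eq_zero] at h
    rw [h, mul_assoc]
  have h5 : sphereAvg n (X e * q * p) = c * sphereAvg n (q * q) := by
    rw [mul_right_comm, hX, mul_assoc, sphereAvg_C_mul, mul_assoc, sphereAvg_sum_sq_mul]
  have h6 : p * p + C (1 - 2 * c) * (X e * q * p) -
      C c * ((∑ i : Fin n, X i ^ 2) * (pderiv e q * p)) = 0 := by
    have h7 := congrArg (pderiv e) hX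
    simp only [pderiv_mul, pderiv_X_self, pderiv_C, pderiv_sum_sq, ← hqdef] at h7
    simp only [map_sub, map_mul, map_one, map_ofNat]
    linear_combination p * h7
  have h7 := congrArg (sphereAvg n) h6
  rw [map_sub, map_add, sphereAvg_C_mul, sphereAvg_C_mul, sphereAvg_sum_sq_mul, h5, map_zero,
    sphereAvg_mul_eq_zero hn (by omega) (pderiv_mem_hhpSub hq e) hp] at h7
  have h8 : 0 ≤ (1 - 2 * c) * (c * sphereAvg n (q * q)) :=
    mul_nonneg (by linarith) (mul_nonneg hc0 (sphereAvg_mul_self_nonneg q))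
  exact eq_zero_of_sphereAvg_mul_self hn (mem_hhpSub.1 hp).1
    (le_antisymm (by linarith) (sphereAvg_mul_self_nonneg p))

lemma exists_raise_eq (hn : 2 ≤ n) (hd : 1 ≤ d) {h : MvPolynomial (Fin n) ℝ}
    (hh : h ∈ hhpSub n d)
    (horth : ∀ q ∈ hhpSub n d, pderiv e q = 0 → sphereAvg n (h * q) = 0) :
    ∃ p ∈ hhpSub n (d - 1), raise n d e p = h := by
  have : FiniteDimensional ℝ (homogeneousSubmodule (Fin n) ℝ (d - 1)) :=
    Module.Finite.iff_fg.2 (homogeneousSubmodule_fg _ _ _)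
  have : FiniteDimensional ℝ (hhpSub n (d - 1)) :=
    Submodule.finiteDimensional_of_le inf_le_left
  let T : hhpSub n (d - 1) →ₗ[ℝ] hhpSub n (d - 1) :=
    { toFun := fun p => ⟨pderiv e (raise n d e p),
        pderiv_mem_hhpSub (raise_mem_hhpSub hn hd p.2) e⟩
      map_add' := fun p q => by ext1; simp [raise_add]
      map_smul' := fun c p => by ext1; simp [raise_smul] }
  have hT : Function.Injective T := by
    rw [injective_iff_map_eq_zero]
    intro p hp
    have h0 : pderiv e (raise n d e p) = 0 := congrArg Subtype.val hp
    have hK := raise_mem_hhpSub (e := e) hn hd p.2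
    exact Subtype.ext <| eq_zero_of_raise_eq_zero hn hd p.2 <|
      eq_zero_of_sphereAvg_mul_self hn (mem_hhpSub.1 hK).1 <|
        sphereAvg_raise_mul_eq_zero hn hd p.2 hK h0
  obtain ⟨p, hp⟩ := LinearMap.injective_iff_surjective.1 hT
    ⟨pderiv e h, pderiv_mem_hhpSub hh e⟩
  have hp' : pderiv e (raise n d e p) = pderiv e h := congrArg Subtype.val hp
  have hw := sub_mem hh (raise_mem_hhpSub (e := e) hn hd p.2)
  have hw0 : pderiv e (h - raise n d e p) = 0 := by rw [map_sub, hp', sub_self]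
  refine ⟨p, p.2, (sub_eq_zero.1 ?_).symm⟩
  refine eq_zero_of_sphereAvg_mul_self hn (mem_hhpSub.1 hw).1 ?_
  rw [sub_mul, map_sub, horth _ hw hw0, sphereAvg_raise_mul_eq_zero hn hd p.2 hw hw0, sub_zero]

lemma sphereAvg_raise_mul_self_le (hn : 2 ≤ n) (hd : 1 ≤ d) {p : MvPolynomial (Fin n) ℝ}
    (hp : p ∈ hhpSub n (d - 1)) :
    sphereAvg n (raise n d e p * raise n d e p) ≤ sphereAvg n (X e * p * (X e * p)) := by
  have hK := raise_mem_hhpSub (e := e) hn hd hp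
  have hq := pderiv_mem_hhpSub hp e
  set c : ℝ := 1 / (2 * (d : ℝ) + n - 4) with hc
  have h : X e * p * (X e * p) = raise n d e p * raise n d e p +
      C (2 * c) * ((∑ i : Fin n, X i ^ 2) * (raise n d e p * pderiv e p)) +
      C (c ^ 2) * ((∑ i : Fin n, X i ^ 2) * ((∑ i : Fin n, X i ^ 2) *
        (pderiv e p * pderiv e p))) := by
    simp only [raise, map_mul, map_pow, map_ofNat, ← hc]
    ring
  rw [h, map_add, map_add, sphereAvg_C_mul, sphereAvg_C_mul, sphereAvg_sum_sq_mul,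
    sphereAvg_sum_sq_mul, sphereAvg_sum_sq_mul, sphereAvg_mul_eq_zero hn (by omega) hK hq]
  nlinarith [mul_nonneg (sq_nonneg c) (sphereAvg_mul_self_nonneg (pderiv e p))]

lemma sphereAvg_X_mul_self_le (p : MvPolynomial (Fin n) ℝ) :
    sphereAvg n (X e * p * (X e * p)) ≤ sphereAvg n (p * p) := by
  have h : (∑ i : Fin n, X i ^ 2) * (p * p) = ∑ i, X i * p * (X i * p) := by
    rw [Finset.sum_mul]
    exact Finset.sum_congr rfl fun i _ => by ring
  rw [← sphereAvg_sum_sq_mul (p * p), h, map_sum]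
  exact Finset.single_le_sum (f := fun i => sphereAvg n (X i * p * (X i * p)))
    (fun i _ => sphereAvg_mul_self_nonneg _) (Finset.mem_univ e)

end Harmonic

theorem stmt7 (n d : ℕ) (hn : 2 ≤ n) (hd : 1 ≤ d) :
    ∀ K : MvPolynomial (Fin n) ℝ → MvPolynomial (Fin n) ℝ,
      (K = fun p => MvPolynomial.X (⟨0, by omega⟩ : Fin n) * p
          - MvPolynomial.C (1 / (2 * (d : ℝ) + n - 4))
            * (∑ i : Fin n, MvPolynomial.X i ^ 2)
            * MvPolynomial.pderiv (⟨0, by omega⟩ : Fin n) p) →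
      -- `K` is linear
      (∀ p q : MvPolynomial (Fin n) ℝ, K (p + q) = K p + K q)
      ∧ (∀ (c : ℝ) (p : MvPolynomial (Fin n) ℝ), K (c • p) = c • K p)
      -- `K` maps `𝒫_{d-1}` into the orthogonal complement of the `x₁`-invariant part of `𝒫_d`
      ∧ (∀ p ∈ hhpSub n (d - 1), K p ∈ hhpSub n d ∧
          ∀ q ∈ hhpSub n d, MvPolynomial.pderiv (⟨0, by omega⟩ : Fin n) q = 0 →
            sInner n (pev n (K p)) (pev n q) = 0)
      -- injectivity
      ∧ (∀ p ∈ hhpSub n (d - 1), ∀ p' ∈ hhpSub n (d - 1), K p = K p' → p = p')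
      -- surjectivity onto the orthogonal complement
      ∧ (∀ h ∈ hhpSub n d,
          (∀ q ∈ hhpSub n d, MvPolynomial.pderiv (⟨0, by omega⟩ : Fin n) q = 0 →
            sInner n (pev n h) (pev n q) = 0) →
          ∃ p ∈ hhpSub n (d - 1), K p = h)
      -- norm estimates
      ∧ (∀ p ∈ hhpSub n (d - 1),
          sNorm n (pev n (K p)) ≤ sNorm n (fun x => x (⟨0, by omega⟩ : Fin n) * pev n p x)
          ∧ sNorm n (fun x => x (⟨0, by omega⟩ : Fin n) * pev n p x) ≤ sNorm n (pev n p)) := by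

  rintro K rfl
  set e : Fin n := ⟨0, by omega⟩
  have hX (p : MvPolynomial (Fin n) ℝ) :
      (fun x : E n => x e * pev n p x) = pev n (MvPolynomial.X e * p) := by
    ext; simp [pev]
  refine ⟨raise_add (d := d) (e := e), raise_smul (d := d) (e := e), fun p hp =>
    ⟨raise_mem_hhpSub hn hd hp, fun q hq he => ?_⟩, fun p hp p' hp' h => ?_,
    fun h hh horth => ?_, fun p hp => ?_⟩
  · rw [sInner_pev]
    exact sphereAvg_raise_mul_eq_zero hn hd hp hq he
  · change raise n d e p = raise n d e p' at h
    refine sub_eq_zero.1 (eq_zero_of_raise_eq_zero (e := e) hn hd (sub_mem hp hp') ?_)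
    rw [sub_eq_add_neg, ← neg_one_smul ℝ p', raise_add, raise_smul, h]
    simp
  · simp only [sInner_pev] at horth
    exact exists_raise_eq hn hd hh horth
  · rw [hX, sNorm_pev, sNorm_pev, sNorm_pev]
    exact ⟨Real.sqrt_le_sqrt (sphereAvg_raise_mul_self_le hn hd hp),
      Real.sqrt_le_sqrt (sphereAvg_X_mul_self_le p)⟩
end
end

section
/- For any homogeneous harmonic polynomial p of degree d on ℝⁿ, the inner product ⟨p, x₁ ∂₁ p⟩ over the unit sphere equals ‖∂₁ p‖² / (2d + n − 2); in particular ⟨p, x₁∂₁p⟩ ≥ 0. -/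
open MeasureTheory Metric

noncomputable section

/-- A real polynomial seen as a function on Euclidean space. -/
def polyFun {n : ℕ} (p : MvPolynomial (Fin n) ℝ) (x : E n) : ℝ :=
  MvPolynomial.eval (fun i => x i) p

lemma hasFDerivAt_polyFun {n : ℕ} (p : MvPolynomial (Fin n) ℝ) (x : E n) :
    HasFDerivAt (polyFun p)
      (∑ i, polyFun (MvPolynomial.pderiv i p) x • EuclideanSpace.proj (𝕜 := ℝ) i) x := by
  induction p using MvPolynomial.induction_on with
  | C a =>
    have h : polyFun (MvPolynomial.C a) = fun _ : E n => a := by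
      ext y; simp [polyFun]
    rw [h]
    refine (hasFDerivAt_const a x).congr_fderiv ?_
    simp [polyFun]
  | add p q hp hq =>
    have h : polyFun (p + q) = fun y : E n => polyFun p y + polyFun q y := by
      ext y; simp [polyFun]
    rw [h]
    refine (hp.add hq).congr_fderiv ?_
    simp [polyFun, add_smul, Finset.sum_add_distrib]
  | mul_X p j hp =>
    have h : polyFun (p * MvPolynomial.X j) = fun y : E n => polyFun p y * y j := by
      ext y; simp [polyFun]
    rw [h]
    refine (hp.mul (EuclideanSpace.proj (𝕜 := ℝ) j : E n →L[ℝ] ℝ).hasFDerivAt).congr_fderiv ?_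
    ext v
    simp [polyFun, MvPolynomial.pderiv_X, Pi.single_apply, add_mul, Finset.sum_add_distrib,
      Finset.mul_sum, mul_assoc, apply_ite]

lemma pd_polyFun {n : ℕ} (p : MvPolynomial (Fin n) ℝ) (i : Fin n) :
    pd n i (polyFun p) = polyFun (MvPolynomial.pderiv i p) := by
  ext x
  simp [pd, (hasFDerivAt_polyFun p x).fderiv]

/-- The polynomial Laplacian. -/
def polyLap {n : ℕ} (p : MvPolynomial (Fin n) ℝ) : MvPolynomial (Fin n) ℝ :=
  ∑ i, MvPolynomial.pderiv i (MvPolynomial.pderiv i p)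

lemma lap_polyFun {n : ℕ} (p : MvPolynomial (Fin n) ℝ) :
    lap n (polyFun p) = polyFun (polyLap p) := by
  ext x
  have h : lap n (polyFun p) x = ∑ i, pd n i (pd n i (polyFun p)) x := rfl
  simp [h, pd_polyFun, polyFun, polyLap]

lemma polyFun_smul {n m : ℕ} {p : MvPolynomial (Fin n) ℝ} (hp : p.IsHomogeneous m)
    (r : ℝ) (x : E n) : polyFun p (r • x) = r ^ m * polyFun p x := by
  simp only [polyFun, MvPolynomial.eval_eq, Finset.mul_sum]
  refine Finset.sum_congr rfl fun a ha => ?_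
  have hdeg : ∑ i ∈ a.support, a i = m := by
    simpa [Finsupp.weight_apply, Finsupp.sum] using hp (MvPolynomial.mem_support_iff.mp ha)
  simp only [PiLp.smul_apply, smul_eq_mul, mul_pow, Finset.prod_mul_distrib,
    Finset.prod_pow_eq_pow_sum, hdeg]
  ring

lemma integrable_pow_mul_exp_neg_sq (k : ℕ) :
    Integrable fun x : ℝ => x ^ k * Real.exp (-x ^ 2) := by
  have h : (-1 : ℝ) < k := by linarith [k.cast_nonneg (α := ℝ)]
  simpa [Real.rpow_natCast] using integrable_rpow_mul_exp_neg_mul_sq one_pos h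

lemma integrable_polyFun_mul_exp {n : ℕ} (p : MvPolynomial (Fin n) ℝ) :
    Integrable fun x : E n => polyFun p x * Real.exp (-‖x‖ ^ 2) := by
  induction p using MvPolynomial.induction_on' with
  | monomial a c =>
    have h := (Integrable.fintype_prod (μ := fun _ : Fin n => (volume : Measure ℝ))
      fun i => integrable_pow_mul_exp_neg_sq (a i)).const_mul c
    have h2 := (EuclideanSpace.volume_preserving_symm_measurableEquiv_toLp
      (Fin n)).integrable_comp_of_integrable h
    refine h2.congr (.of_forall fun x => ?_)
    simp [polyFun, MvPolynomial.eval_monomial, EuclideanSpace.real_norm_sq_eq, Finsupp.prod_fintype,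
      Finset.prod_mul_distrib, ← Finset.sum_neg_distrib, Real.exp_sum, mul_assoc]
  | add p q hp hq =>
    refine (hp.add hq).congr (.of_forall fun x => ?_)
    simp [polyFun, add_mul]

/-- Integration of a polynomial against the Gaussian weight. -/
def gaussInt {n : ℕ} (p : MvPolynomial (Fin n) ℝ) : ℝ :=
  ∫ x : E n, polyFun p x * Real.exp (-‖x‖ ^ 2)

lemma gaussInt_add {n : ℕ} (p q : MvPolynomial (Fin n) ℝ) :
    gaussInt (p + q) = gaussInt p + gaussInt q := by
  rw [gaussInt, gaussInt, gaussInt,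
    ← integral_add (integrable_polyFun_mul_exp p) (integrable_polyFun_mul_exp q)]
  simp [polyFun, add_mul]

lemma gaussInt_zero {n : ℕ} : gaussInt (0 : MvPolynomial (Fin n) ℝ) = 0 := by
  simp [gaussInt, polyFun]

lemma gaussInt_sum {n : ℕ} {ι : Type*} (s : Finset ι) (p : ι → MvPolynomial (Fin n) ℝ) :
    gaussInt (∑ i ∈ s, p i) = ∑ i ∈ s, gaussInt (p i) :=
  map_sum (⟨⟨gaussInt, gaussInt_zero⟩, gaussInt_add⟩ : MvPolynomial (Fin n) ℝ →+ ℝ) p s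

lemma gaussInt_nsmul {n : ℕ} (k : ℕ) (p : MvPolynomial (Fin n) ℝ) :
    gaussInt (k • p) = k * gaussInt p := by
  simpa using map_nsmul
    (⟨⟨gaussInt, gaussInt_zero⟩, gaussInt_add⟩ : MvPolynomial (Fin n) ℝ →+ ℝ) k p

/-- Gaussian integration by parts. -/
lemma two_mul_gaussInt_X_mul {n : ℕ} (i : Fin n) (p : MvPolynomial (Fin n) ℝ) :
    2 * gaussInt (MvPolynomial.X i * p) = gaussInt (MvPolynomial.pderiv i p) := by
  have hw (x : E n) : HasFDerivAt (fun y : E n => Real.exp (-‖y‖ ^ 2))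
      (Real.exp (-‖x‖ ^ 2) • -((2 : ℕ) • innerSL ℝ x : E n →L[ℝ] ℝ)) x :=
    ((hasStrictFDerivAt_norm_sq x).hasFDerivAt.neg).exp
  have hint := (integrable_polyFun_mul_exp (MvPolynomial.X i * p)).const_mul (-2)
  have heq (x : E n) : polyFun p x * (Real.exp (-‖x‖ ^ 2) • -((2 : ℕ) • innerSL ℝ x : E n →L[ℝ] ℝ))
      (EuclideanSpace.single i 1) =
      -2 * (polyFun (MvPolynomial.X i * p) x * Real.exp (-‖x‖ ^ 2)) := by
    simp [polyFun, EuclideanSpace.inner_single_right]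
    ring
  have hpd (x : E n) : fderiv ℝ (polyFun p) x (EuclideanSpace.single i 1) =
      polyFun (MvPolynomial.pderiv i p) x := congrFun (pd_polyFun p i) x
  have key := integral_mul_fderiv_eq_neg_fderiv_mul_of_integrable (μ := (volume : Measure (E n)))
    (f := polyFun p) (g := fun y : E n => Real.exp (-‖y‖ ^ 2)) (v := EuclideanSpace.single i 1)
    (by simpa only [hpd] using integrable_polyFun_mul_exp (MvPolynomial.pderiv i p))
    (by simpa only [(hw _).fderiv, heq] using hint)
    (integrable_polyFun_mul_exp p)
    (fun x _ => (hasFDerivAt_polyFun p x).differentiableAt)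
    (fun x _ => (hw x).differentiableAt)
  simp only [(hw _).fderiv, heq, hpd, integral_const_mul] at key
  simp only [gaussInt]
  linarith

lemma polyLap_pderiv {n : ℕ} {p : MvPolynomial (Fin n) ℝ} (hp : polyLap p = 0) (i : Fin n) :
    polyLap (MvPolynomial.pderiv i p) = 0 := by
  have h (j : Fin n) (q : MvPolynomial (Fin n) ℝ) : MvPolynomial.pderiv j (MvPolynomial.pderiv i q)
      = MvPolynomial.pderiv i (MvPolynomial.pderiv j q) := by
    have : ⁅MvPolynomial.pderiv (R := ℝ) j, MvPolynomial.pderiv i⁆ = 0 :=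
      MvPolynomial.derivation_ext fun k => by
        rw [Derivation.commutator_apply]
        simp [MvPolynomial.pderiv_X, Pi.single_apply, apply_ite]
    simpa [Derivation.commutator_apply, sub_eq_zero] using congrArg (fun D => D q) this
  simpa [polyLap, h] using congrArg (MvPolynomial.pderiv i) hp

lemma two_mul_degree_mul_gaussInt_mul {n k : ℕ} {f : MvPolynomial (Fin n) ℝ}
    (hf : f.IsHomogeneous k) (hlap : polyLap f = 0) (g : MvPolynomial (Fin n) ℝ) :
    2 * (k * gaussInt (f * g)) =
      ∑ i, gaussInt (MvPolynomial.pderiv i f * MvPolynomial.pderiv i g) := by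
  rw [← gaussInt_nsmul, ← smul_mul_assoc, ← hf.sum_X_mul_pderiv, Finset.sum_mul, gaussInt_sum,
    Finset.mul_sum]
  simp only [mul_assoc, two_mul_gaussInt_X_mul, Derivation.leibniz, smul_eq_mul]
  rw [← gaussInt_sum, ← gaussInt_sum, Finset.sum_add_distrib, ← Finset.mul_sum]
  have h : ∑ i, MvPolynomial.pderiv i (MvPolynomial.pderiv i f) = 0 := hlap
  simp [h]

/-- Harmonic polynomials of different degrees are orthogonal for the Gaussian weight. -/
lemma gaussInt_mul_eq_zero {n k l : ℕ} {f g : MvPolynomial (Fin n) ℝ}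
    (hf : f.IsHomogeneous k) (hg : g.IsHomogeneous l) (hlf : polyLap f = 0) (hlg : polyLap g = 0)
    (hkl : k ≠ l) : gaussInt (f * g) = 0 := by
  have h1 := two_mul_degree_mul_gaussInt_mul hf hlf g
  have h2 := two_mul_degree_mul_gaussInt_mul hg hlg f
  simp only [mul_comm g f, mul_comm (MvPolynomial.pderiv _ g)] at h2
  have h3 : ((k : ℝ) - l) * gaussInt (f * g) = 0 := by linarith
  exact (mul_eq_zero.mp h3).resolve_left (sub_ne_zero.mpr (by exact_mod_cast hkl))

lemma integral_volumeIoiPow_pow_mul_exp {n : ℕ} (hn : 1 ≤ n) (m : ℕ) :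
    ∫ r : Set.Ioi (0 : ℝ), (r : ℝ) ^ m * Real.exp (-(r : ℝ) ^ 2) ∂Measure.volumeIoiPow (n - 1) =
      1 / 2 * Real.Gamma (((n : ℝ) + m) / 2) := by
  simp only [Measure.volumeIoiPow, ENNReal.ofReal]
  rw [integral_withDensity_eq_integral_smul
      (measurable_subtype_coe.pow_const _).real_toNNReal,
    integral_subtype_comap measurableSet_Ioi fun a : ℝ ↦
      Real.toNNReal (a ^ (n - 1)) • (a ^ m * Real.exp (-a ^ 2))]
  have hm : (-1 : ℝ) < ((n - 1 + m : ℕ) : ℝ) := by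
    linarith [(n - 1 + m).cast_nonneg (α := ℝ)]
  have h := integral_rpow_mul_exp_neg_rpow two_pos hm
  have hc : (((n - 1 + m : ℕ) : ℝ) + 1) / 2 = ((n : ℝ) + m) / 2 := by
    push_cast [hn]; ring
  rw [hc] at h
  rw [← h]
  refine setIntegral_congr_fun measurableSet_Ioi fun x hx => ?_
  simp only [NNReal.smul_def, Real.coe_toNNReal _ (pow_nonneg (le_of_lt hx) _), smul_eq_mul,
    Real.rpow_natCast, Real.rpow_two, pow_add, mul_assoc]

/-- Polar coordinates for the Gaussian integral of a homogeneous polynomial. -/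
lemma gaussInt_eq_integral_sphere {n m : ℕ} (hn : 1 ≤ n) {p : MvPolynomial (Fin n) ℝ}
    (hp : p.IsHomogeneous m) :
    gaussInt p = (∫ y : sphere (0 : E n) 1, polyFun p y ∂(volume : Measure (E n)).toSphere) *
      (1 / 2 * Real.Gamma (((n : ℝ) + m) / 2)) := by
  have : Nonempty (Fin n) := ⟨⟨0, hn⟩⟩
  rw [← integral_volumeIoiPow_pow_mul_exp hn, ← integral_prod_mul]
  have h := (volume : Measure (E n)).measurePreserving_homeomorphUnitSphereProd.symm
    (homeomorphUnitSphereProd (E n)).toMeasurableEquiv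
  rw [finrank_euclideanSpace_fin] at h
  calc
    gaussInt p = ∫ x : ({(0)}ᶜ : Set (E n)), polyFun p x * Real.exp (-‖(x : E n)‖ ^ 2)
        ∂((volume : Measure (E n)).comap (↑)) := by
      rw [integral_subtype_comap (measurableSet_singleton _).compl
        fun x : E n ↦ polyFun p x * Real.exp (-‖x‖ ^ 2), restrict_compl_singleton, gaussInt]
    _ = _ := by
      rw [← h.integral_comp (MeasurableEquiv.measurableEmbedding _)]
      refine integral_congr_ae (.of_forall fun z => ?_)
      have hz : (((homeomorphUnitSphereProd (E n)).symm z : ({0}ᶜ : Set (E n))) : E n)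
          = (z.2 : ℝ) • (z.1 : E n) := rfl
      change polyFun p ((homeomorphUnitSphereProd (E n)).symm z : ({0}ᶜ : Set (E n))) *
        Real.exp (-‖(((homeomorphUnitSphereProd (E n)).symm z : ({0}ᶜ : Set (E n))) : E n)‖ ^ 2) = _
      rw [hz, polyFun_smul hp, norm_smul, norm_eq_of_mem_sphere]
      simp
      ring

lemma toSphere_real_univ_ne_zero {n : ℕ} (hn : 1 ≤ n) :
    (volume : Measure (E n)).toSphere.real Set.univ ≠ 0 := by
  have h : (volume : Measure (E n)).real (ball 0 1) ≠ 0 :=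
    (ENNReal.toReal_pos (measure_ball_pos _ _ one_pos).ne' measure_ball_lt_top.ne).ne'
  simpa [h] using Nat.one_le_iff_ne_zero.mp hn

lemma gaussInt_eq_sAvg {n m : ℕ} (hn : 1 ≤ n) {p : MvPolynomial (Fin n) ℝ}
    (hp : p.IsHomogeneous m) :
    gaussInt p = sAvg n (polyFun p) * (volume : Measure (E n)).toSphere.real Set.univ *
      (1 / 2 * Real.Gamma (((n : ℝ) + m) / 2)) := by
  have h := toSphere_real_univ_ne_zero hn
  rw [gaussInt_eq_integral_sphere hn hp, sAvg, average_eq, smul_eq_mul]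
  field_simp

theorem stmt8 (n d : ℕ) (hn : 2 ≤ n) (hd : 1 ≤ d)
    (p : E n → ℝ) (hp : IsHHP n d p) :
    sInner n p (fun x => x (⟨0, by omega⟩ : Fin n) * pd n (⟨0, by omega⟩ : Fin n) p x)
        = (sNorm n (pd n (⟨0, by omega⟩ : Fin n) p)) ^ 2 / (2 * (d : ℝ) + n - 2)
    ∧ 0 ≤ sInner n p (fun x => x (⟨0, by omega⟩ : Fin n)
        * pd n (⟨0, by omega⟩ : Fin n) p x) := by
  obtain ⟨⟨P, hP, hpP⟩, hlap⟩ := hp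
  obtain rfl : p = polyFun P := funext hpP
  have hL : polyLap P = 0 := MvPolynomial.funext fun v => by
    simpa [lap_polyFun, polyFun] using hlap (WithLp.toLp 2 v)
  generalize (⟨0, by omega⟩ : Fin n) = i
  set Q := MvPolynomial.pderiv i P
  obtain ⟨e, rfl⟩ : ∃ e, d = e + 1 := ⟨d - 1, by omega⟩
  have hQe : Q.IsHomogeneous e := hP.pderiv
  have hgauss : 2 * gaussInt (MvPolynomial.X i * (P * Q)) = gaussInt (Q * Q) := by
    rw [two_mul_gaussInt_X_mul, Derivation.leibniz, smul_eq_mul, smul_eq_mul, gaussInt_add,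
      gaussInt_mul_eq_zero hP hQe.pderiv hL (polyLap_pderiv (polyLap_pderiv hL i) i) (by omega),
      zero_add]
  rw [gaussInt_eq_sAvg (by omega) ((MvPolynomial.isHomogeneous_X ℝ i).mul (hP.mul hQe)),
    gaussInt_eq_sAvg (by omega) (hQe.mul hQe)] at hgauss
  have hn' : (2 : ℝ) ≤ n := by exact_mod_cast hn
  have hpos : (0 : ℝ) < ((n : ℝ) + (e + e : ℕ)) / 2 := by positivity
  have hG : Real.Gamma (((n : ℝ) + (1 + (e + 1 + e) : ℕ)) / 2) =
      ((n : ℝ) + (e + e : ℕ)) / 2 * Real.Gamma (((n : ℝ) + (e + e : ℕ)) / 2) := by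
    rw [← Real.Gamma_add_one hpos.ne']
    congr 1
    push_cast
    ring
  have hσ := toSphere_real_univ_ne_zero (n := n) (by omega)
  have hI : sInner n (polyFun P) (fun x => x i * pd n i (polyFun P) x) =
      sAvg n (polyFun (MvPolynomial.X i * (P * Q))) := by
    rw [pd_polyFun, sInner]
    congr 1
    ext x
    simp [polyFun, Q]
    ring
  have hS : sNorm n (pd n i (polyFun P)) ^ 2 = sAvg n (polyFun (Q * Q)) := by
    rw [sNorm, Real.sq_sqrt, pd_polyFun]
    · congr 1
      ext x
      simp [polyFun, Q, sq]
    · exact integral_nonneg fun y => sq_nonneg _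
  have hden : (0 : ℝ) < 2 * ((e + 1 : ℕ) : ℝ) + n - 2 := by
    push_cast
    linarith [e.cast_nonneg (α := ℝ)]
  have main : sInner n (polyFun P) (fun x => x i * pd n i (polyFun P) x) =
      sNorm n (pd n i (polyFun P)) ^ 2 / (2 * ((e + 1 : ℕ) : ℝ) + n - 2) := by
    rw [eq_div_iff hden.ne', hI, hS]
    rw [hG] at hgauss
    have hΓ := (Real.Gamma_pos_of_pos hpos).ne'
    refine mul_right_cancel₀ (mul_ne_zero hσ hΓ) ?_
    push_cast at hgauss ⊢
    linear_combination 2 * hgauss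
  exact ⟨main, main ▸ div_nonneg (sq_nonneg _) hden.le⟩
end
end

section
/- If h is a homogeneous harmonic polynomial of degree d on ℝⁿ orthogonal (in L²(∂B(0,1))) to all x₁-invariant homogeneous harmonic polynomials of degree d, then ‖h‖ ≤ ‖∂₁h‖. -/
open MeasureTheory Metric

noncomputable section

namespace GaussianHarmonic
open MvPolynomial

variable {n : ℕ}

def toFun (p : MvPolynomial (Fin n) ℝ) (x : E n) : ℝ := eval (fun i => x i) p

def weight (x : E n) : ℝ := Real.exp (-(1 / 2) * ‖x‖ ^ 2)

lemma hasFDerivAt_toFun (p : MvPolynomial (Fin n) ℝ) (x : E n) :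
    HasFDerivAt (toFun p)
      (∑ i, toFun (pderiv i p) x • (EuclideanSpace.proj i : E n →L[ℝ] ℝ)) x := by
  induction p using MvPolynomial.induction_on with
  | C a =>
    have h : toFun (C a) = fun _ : E n => a := by ext; simp [toFun]
    rw [h]
    refine (hasFDerivAt_const a x).congr_fderiv ?_
    simp [toFun]
  | add p q hp hq =>
    have h : toFun (p + q) = toFun p + toFun q := by ext; simp [toFun]
    rw [h]
    refine (hp.add hq).congr_fderiv ?_
    simp [toFun, add_smul, Finset.sum_add_distrib]
  | mul_X p j hp =>
    have hj : HasFDerivAt (fun y : E n => y j) (EuclideanSpace.proj j : E n →L[ℝ] ℝ) x :=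
      (EuclideanSpace.proj j : E n →L[ℝ] ℝ).hasFDerivAt
    have h : toFun (p * X j) = toFun p * fun y : E n => y j := by ext; simp [toFun]
    rw [h]
    refine (hp.mul hj).congr_fderiv ?_
    ext v
    simp [toFun, pderiv_X, Pi.single_apply, add_mul, Finset.sum_add_distrib, Finset.mul_sum,
      apply_ite, ite_mul, mul_assoc]

lemma fderiv_toFun (p : MvPolynomial (Fin n) ℝ) (x : E n) (i : Fin n) :
    fderiv ℝ (toFun p) x (EuclideanSpace.single i 1) = toFun (pderiv i p) x := by
  rw [(hasFDerivAt_toFun p x).fderiv]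
  simp

lemma differentiable_toFun (p : MvPolynomial (Fin n) ℝ) : Differentiable ℝ (toFun p) :=
  fun x => (hasFDerivAt_toFun p x).differentiableAt

lemma integrable_toFun_mul_weight (p : MvPolynomial (Fin n) ℝ) :
    Integrable fun x : E n => toFun p x * weight x := by
  induction p using MvPolynomial.induction_on' with
  | add p q hp hq =>
    refine (hp.add hq).congr (.of_forall fun x => ?_)
    simp [toFun, add_mul]
  | monomial u a =>
    have h1 (k : ℕ) : Integrable fun t : ℝ => t ^ k * Real.exp (-(1 / 2) * t ^ 2) := by
      have := integrable_rpow_mul_exp_neg_mul_sq (b := 1 / 2) (by norm_num) (s := k)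
        (by have : (0 : ℝ) ≤ k := k.cast_nonneg
            linarith)
      simpa using this
    rw [← (PiLp.volume_preserving_toLp (Fin n)).integrable_comp_emb
      (MeasurableEquiv.toLp 2 _).measurableEmbedding]
    refine ((Integrable.fintype_prod fun i => h1 (u i)).const_mul a).congr (.of_forall fun x => ?_)
    simp [toFun, weight, EuclideanSpace.real_norm_sq_eq, eval_monomial, Finset.prod_mul_distrib,
      ← Real.exp_sum, Finset.mul_sum, Finsupp.prod_fintype, mul_assoc]

lemma hasFDerivAt_weight (x : E n) :
    HasFDerivAt weight (-weight x • innerSL ℝ x) x := by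
  have h := (((hasStrictFDerivAt_norm_sq x).hasFDerivAt.const_mul (-(1 / 2) : ℝ))).exp
  refine h.congr_fderiv ?_
  ext v
  simp [weight]

def gaussInt : MvPolynomial (Fin n) ℝ →ₗ[ℝ] ℝ where
  toFun p := ∫ x : E n, toFun p x * weight x
  map_add' p q := by
    rw [← integral_add (integrable_toFun_mul_weight p) (integrable_toFun_mul_weight q)]
    simp [toFun, add_mul]
  map_smul' c p := by
    simp [toFun, mul_assoc, integral_const_mul]

lemma gaussInt_pderiv (i : Fin n) (p : MvPolynomial (Fin n) ℝ) :
    gaussInt (pderiv i p) = gaussInt (X i * p) := by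
  have key (x : E n) : toFun p x * fderiv ℝ weight x (EuclideanSpace.single i 1) =
      -(toFun (X i * p) x * weight x) := by
    rw [(hasFDerivAt_weight x).fderiv]
    simp [toFun, EuclideanSpace.inner_single_right]
    ring
  have h := integral_mul_fderiv_eq_neg_fderiv_mul_of_integrable (μ := (volume : Measure (E n)))
    (v := EuclideanSpace.single i (1 : ℝ)) (f := toFun p) (g := weight) ?_ ?_
    (integrable_toFun_mul_weight p) (fun x _ => differentiable_toFun p x)
    (fun x _ => (hasFDerivAt_weight x).differentiableAt)
  · simp only [key, fderiv_toFun, integral_neg, neg_inj] at h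
    exact h.symm
  · simpa only [fderiv_toFun] using integrable_toFun_mul_weight _
  · simp only [key]
    exact (integrable_toFun_mul_weight _).neg

lemma gaussInt_mul_self_nonneg (p : MvPolynomial (Fin n) ℝ) : 0 ≤ gaussInt (p * p) := by
  refine integral_nonneg fun x => ?_
  simp only [toFun, map_mul, weight]
  exact mul_nonneg (mul_self_nonneg _) (Real.exp_pos _).le

lemma toFun_injective : Function.Injective (toFun (n := n)) := fun _ _ h =>
  MvPolynomial.funext fun x => congrFun h (WithLp.toLp 2 x)

lemma eq_zero_of_gaussInt_mul_self (p : MvPolynomial (Fin n) ℝ) (h : gaussInt (p * p) = 0) :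
    p = 0 := by
  have hnn : 0 ≤ fun x : E n => toFun (p * p) x * weight x := fun x => by
    simp only [toFun, map_mul, weight]
    exact mul_nonneg (mul_self_nonneg _) (Real.exp_pos _).le
  have hc : Continuous fun x : E n => toFun (p * p) x * weight x :=
    (differentiable_toFun _).continuous.mul
      (continuous_iff_continuousAt.2 fun x => (hasFDerivAt_weight x).continuousAt)
  have h0 := (integral_eq_zero_iff_of_nonneg hnn (integrable_toFun_mul_weight _)).1 h
  have h1 := (hc.ae_eq_iff_eq volume continuous_zero).1 h0
  refine toFun_injective (funext fun x => ?_)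
  have h2 := congrFun h1 x
  simpa [toFun, weight, Real.exp_ne_zero] using h2


lemma toFun_smul {p : MvPolynomial (Fin n) ℝ} {m : ℕ} (hp : p.IsHomogeneous m) (r : ℝ) (x : E n) :
    toFun p (r • x) = r ^ m * toFun p x := by
  simp only [toFun, eval_eq', Finset.mul_sum]
  refine Finset.sum_congr rfl fun s hs => ?_
  have hdeg : ∑ i, s i = m := by
    rw [← Finsupp.degree_eq_sum, Finsupp.degree_eq_weight_one]
    exact hp (mem_support_iff.1 hs)
  simp only [PiLp.smul_apply, smul_eq_mul, mul_pow, Finset.prod_mul_distrib,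
    Finset.prod_pow_eq_pow_sum, hdeg]
  ring

lemma exists_gaussInt_eq_mul_sAvg (hn : 0 < n) (m : ℕ) :
    ∃ c : ℝ, 0 ≤ c ∧ ∀ p : MvPolynomial (Fin n) ℝ, p.IsHomogeneous m →
      gaussInt p = c * sAvg n (toFun p) := by
  set ν := Measure.volumeIoiPow (Module.finrank ℝ (E n) - 1)
  set σ := (volume : Measure (E n)).toSphere with hσ
  have : NeZero n := ⟨hn.ne'⟩
  refine ⟨σ.real Set.univ * ∫ r : Set.Ioi (0 : ℝ), (r : ℝ) ^ m * Real.exp (-(1 / 2) * r ^ 2) ∂ν,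
    mul_nonneg measureReal_nonneg (integral_nonneg fun r =>
      mul_nonneg (pow_nonneg r.2.le _) (Real.exp_pos _).le), fun p hp => ?_⟩
  calc
    gaussInt p = ∫ x : ({0}ᶜ : Set (E n)), toFun p x.1 * weight x.1
        ∂((volume : Measure (E n)).comap Subtype.val) := by
      rw [integral_subtype_comap (measurableSet_singleton _).compl
        fun x : E n => toFun p x * weight x, restrict_compl_singleton]
      rfl
    _ = ∫ z, toFun p z.1 * ((z.2 : ℝ) ^ m * Real.exp (-(1 / 2) * z.2 ^ 2)) ∂σ.prod ν := by
      rw [← (volume : Measure (E n)).measurePreserving_homeomorphUnitSphereProd.integral_comp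
        (Homeomorph.measurableEmbedding _)]
      refine integral_congr_ae (.of_forall fun x => ?_)
      have hx : ‖x.1‖ ≠ 0 := norm_ne_zero_iff.2 x.2
      have h := toFun_smul hp ‖x.1‖ (‖x.1‖⁻¹ • x.1)
      rw [smul_inv_smul₀ hx] at h
      simp only [homeomorphUnitSphereProd_apply_fst_coe, homeomorphUnitSphereProd_apply_snd_coe]
      rw [h, weight]
      ring
    _ = (∫ y, toFun p y ∂σ) *
        ∫ r : Set.Ioi (0 : ℝ), (r : ℝ) ^ m * Real.exp (-(1 / 2) * r ^ 2) ∂ν :=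
      integral_prod_mul (fun y : sphere (0 : E n) 1 => toFun p y)
        fun r : Set.Ioi (0 : ℝ) => (r : ℝ) ^ m * Real.exp (-(1 / 2) * r ^ 2)
    _ = _ := by
      rw [sAvg, ← hσ, ← measure_smul_average, smul_eq_mul]
      ring

lemma exists_pos_gaussInt_eq_mul_sAvg (hn : 0 < n) (d : ℕ) :
    ∃ c : ℝ, 0 < c ∧ ∀ p : MvPolynomial (Fin n) ℝ, p.IsHomogeneous (d + d) →
      gaussInt p = c * sAvg n (toFun p) := by
  obtain ⟨c, hc, h⟩ := exists_gaussInt_eq_mul_sAvg hn (d + d)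
  refine ⟨c, hc.lt_of_ne' ?_, h⟩
  rintro rfl
  have hX : ((X ⟨0, hn⟩ : MvPolynomial (Fin n) ℝ) ^ d).IsHomogeneous d := by
    simpa using (isHomogeneous_X ℝ (⟨0, hn⟩ : Fin n)).pow d
  have h0 := eq_zero_of_gaussInt_mul_self _ ((h _ (hX.mul hX)).trans (zero_mul _))
  exact pow_ne_zero d (X_ne_zero _) h0

variable {a b e m : ℕ} {p q g : MvPolynomial (Fin n) ℝ}

/-- The polynomial Laplacian. -/
def laplacian : MvPolynomial (Fin n) ℝ →ₗ[ℝ] MvPolynomial (Fin n) ℝ where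
  toFun p := ∑ i, pderiv i (pderiv i p)
  map_add' p q := by simp [Finset.sum_add_distrib]
  map_smul' c p := by simp [Finset.smul_sum]

lemma laplacian_apply (p : MvPolynomial (Fin n) ℝ) :
    laplacian p = ∑ i, pderiv i (pderiv i p) := rfl

lemma pderiv_comm (i j : Fin n) (p : MvPolynomial (Fin n) ℝ) :
    pderiv i (pderiv j p) = pderiv j (pderiv i p) := by
  let D (k : Fin n) : Derivation ℝ (MvPolynomial (Fin n) ℝ) (MvPolynomial (Fin n) ℝ) := pderiv k
  have h : ⁅D i, D j⁆ = 0 := by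
    refine MvPolynomial.derivation_ext fun k => ?_
    simp [D, Derivation.commutator_apply, pderiv_X, Pi.single_apply, apply_ite]
  have hp : ⁅D i, D j⁆ p = 0 := by rw [h, Derivation.zero_apply]
  rwa [Derivation.commutator_apply, sub_eq_zero] at hp

lemma laplacian_pderiv (i : Fin n) (p : MvPolynomial (Fin n) ℝ) :
    laplacian (pderiv i p) = pderiv i (laplacian p) := by
  simp only [laplacian_apply, map_sum]
  exact Finset.sum_congr rfl fun j _ => by rw [pderiv_comm j i, pderiv_comm j i]

lemma laplacian_X_mul (i : Fin n) (p : MvPolynomial (Fin n) ℝ) :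
    laplacian (X i * p) = 2 * pderiv i p + X i * laplacian p := by
  have h (j : Fin n) : pderiv j (pderiv j (X i * p)) =
      2 * (Pi.single (M := fun _ => MvPolynomial (Fin n) ℝ) j 1 i * pderiv j p) +
        X i * pderiv j (pderiv j p) := by
    have h0 : pderiv j (Pi.single (M := fun _ => MvPolynomial (Fin n) ℝ) j 1 i) = 0 := by
      rw [Pi.single_apply]
      split_ifs <;> simp
    simp only [pderiv_mul, map_add, pderiv_X, h0]
    ring
  simp only [laplacian_apply, h, Finset.sum_add_distrib, ← Finset.mul_sum]
  simp [Pi.single_apply]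

/-- The polynomial `∑ i, X i ^ 2`. -/
def normSq : MvPolynomial (Fin n) ℝ := ∑ i, X i * X i

lemma isHomogeneous_normSq : (normSq : MvPolynomial (Fin n) ℝ).IsHomogeneous 2 :=
  .sum _ _ _ fun i _ => (isHomogeneous_X ℝ i).mul (isHomogeneous_X ℝ i)

lemma pderiv_normSq_mul (i : Fin n) (p : MvPolynomial (Fin n) ℝ) :
    pderiv i (normSq * p) = 2 * X i * p + normSq * pderiv i p := by
  have h : pderiv i (normSq : MvPolynomial (Fin n) ℝ) = 2 * X i := by
    simp [normSq, pderiv_X, Pi.single_apply, Finset.sum_add_distrib, two_mul]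
  rw [pderiv_mul, h]

lemma laplacian_normSq_mul (hp : p.IsHomogeneous m) :
    laplacian (normSq * p) = (2 * n + 4 * m) • p + normSq * laplacian p := by
  have h (i : Fin n) : pderiv i (pderiv i (normSq * p)) =
      2 * p + 4 * (X i * pderiv i p) + normSq * pderiv i (pderiv i p) := by
    have h2 : pderiv i (2 : MvPolynomial (Fin n) ℝ) = 0 := by
      simpa using (pderiv i : Derivation ℝ (MvPolynomial (Fin n) ℝ) _).map_natCast 2
    rw [pderiv_normSq_mul, map_add, pderiv_normSq_mul, pderiv_mul, pderiv_mul, pderiv_X_self, h2]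
    ring
  simp only [laplacian_apply, h, Finset.sum_add_distrib, ← Finset.mul_sum, hp.sum_X_mul_pderiv]
  simp
  ring

lemma toFun_normSq_mul {x : E n} (hx : ‖x‖ = 1) (p : MvPolynomial (Fin n) ℝ) :
    toFun (normSq * p) x = toFun p x := by
  have h : toFun normSq x = 1 := by
    have := EuclideanSpace.real_norm_sq_eq x
    simp [toFun, normSq, ← sq, ← this, hx]
  rw [← one_mul (toFun p x), ← h]
  simp [toFun]

lemma gaussInt_normSq_mul (hp : p.IsHomogeneous m) :
    gaussInt (normSq * p) = (n + m : ℝ) * gaussInt p := by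
  have h (i : Fin n) : gaussInt (X i * X i * p) = gaussInt p + gaussInt (X i * pderiv i p) := by
    rw [mul_assoc, ← gaussInt_pderiv, pderiv_mul, pderiv_X_self, one_mul, map_add]
  rw [normSq, Finset.sum_mul, map_sum]
  simp only [h, Finset.sum_add_distrib, ← map_sum, hp.sum_X_mul_pderiv, map_nsmul]
  simp [add_mul]
  rw [← nsmul_eq_mul n p, map_nsmul, nsmul_eq_mul]

lemma sum_gaussInt_pderiv_mul_pderiv (hq : q.IsHomogeneous b) (hq0 : laplacian q = 0)
    (p : MvPolynomial (Fin n) ℝ) :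
    ∑ i, gaussInt (pderiv i p * pderiv i q) = b * gaussInt (p * q) := by
  have h (i : Fin n) : gaussInt (pderiv i p * pderiv i q) =
      gaussInt (p * (X i * pderiv i q)) - gaussInt (p * pderiv i (pderiv i q)) := by
    have := gaussInt_pderiv i (p * pderiv i q)
    rw [pderiv_mul, map_add, mul_left_comm] at this
    linarith
  simp only [h, Finset.sum_sub_distrib, ← map_sum, ← Finset.mul_sum, hq.sum_X_mul_pderiv,
    ← laplacian_apply, hq0, mul_smul_comm, map_nsmul]
  simp

lemma gaussInt_mul_eq_zero (hab : a ≠ b) (hp : p.IsHomogeneous a) (hp0 : laplacian p = 0)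
    (hq : q.IsHomogeneous b) (hq0 : laplacian q = 0) : gaussInt (p * q) = 0 := by
  have h1 := sum_gaussInt_pderiv_mul_pderiv hq hq0 p
  have h2 := sum_gaussInt_pderiv_mul_pderiv hp hp0 q
  simp only [mul_comm q p, fun i => mul_comm (pderiv i q) (pderiv i p)] at h2
  have h3 : ((a : ℝ) - b) * gaussInt (p * q) = 0 := by linarith
  exact (mul_eq_zero.1 h3).resolve_left (sub_ne_zero.2 (Nat.cast_injective.ne hab))

/-- Homogeneous harmonic polynomials of degree `e`. -/
def harmonic (n e : ℕ) : Submodule ℝ (MvPolynomial (Fin n) ℝ) :=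
  homogeneousSubmodule (Fin n) ℝ e ⊓ LinearMap.ker laplacian

lemma mem_harmonic : p ∈ harmonic n e ↔ p.IsHomogeneous e ∧ laplacian p = 0 := Iff.rfl

instance : FiniteDimensional ℝ (harmonic n e) :=
  have : FiniteDimensional ℝ (homogeneousSubmodule (Fin n) ℝ e) :=
    .of_fg (homogeneousSubmodule_fg (σ := Fin n) (R := ℝ) e)
  Submodule.finiteDimensional_of_le inf_le_left

lemma pderiv_mem_harmonic (i : Fin n) (hp : p ∈ harmonic n (e + 1)) :
    pderiv i p ∈ harmonic n e :=
  mem_harmonic.2 ⟨by simpa using hp.1.pderiv (i := i), by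
    rw [laplacian_pderiv, mem_harmonic.1 hp |>.2, map_zero]⟩

lemma pderiv_eq_zero_of_mem_harmonic_zero (i : Fin n) (hp : p ∈ harmonic n 0) :
    pderiv i p = 0 := by
  have h : p.IsHomogeneous 0 := hp.1
  rw [← totalDegree_zero_iff_isHomogeneous, totalDegree_eq_zero_iff_eq_C] at h
  rw [h, pderiv_C]

lemma gaussInt_mul_pderiv_eq_zero (i : Fin n) (hp : p ∈ harmonic n a) (hg : g ∈ harmonic n b)
    (hab : b < a + 1) : gaussInt (p * pderiv i g) = 0 := by
  obtain _ | b := b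
  · rw [pderiv_eq_zero_of_mem_harmonic_zero i hg, mul_zero, map_zero]
  · have hu := pderiv_mem_harmonic i hg
    exact gaussInt_mul_eq_zero (by omega) hp.1 hp.2 hu.1 hu.2

/-- The harmonic projection of `X i * g`, for `g` harmonic and homogeneous of degree `e`. -/
def raise (e : ℕ) (i : Fin n) : MvPolynomial (Fin n) ℝ →ₗ[ℝ] MvPolynomial (Fin n) ℝ :=
  LinearMap.mulLeft ℝ (X i) -
    (1 / (n + 2 * e - 2) : ℝ) • (LinearMap.mulLeft ℝ normSq ∘ₗ (pderiv i).toLinearMap)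

lemma raise_apply (i : Fin n) (g : MvPolynomial (Fin n) ℝ) :
    raise e i g = X i * g - (1 / (n + 2 * e - 2) : ℝ) • (normSq * pderiv i g) := rfl

lemma raise_mem_harmonic (hn : 2 ≤ n) (i : Fin n) (hg : g ∈ harmonic n e) :
    raise e i g ∈ harmonic n (e + 1) := by
  have hX : (X i * g).IsHomogeneous (e + 1) := by
    simpa [add_comm] using (isHomogeneous_X ℝ i).mul hg.1
  rw [raise_apply]
  obtain _ | e := e
  · rw [pderiv_eq_zero_of_mem_harmonic_zero i hg, mul_zero, smul_zero, sub_zero]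
    refine mem_harmonic.2 ⟨hX, ?_⟩
    rw [laplacian_X_mul, (mem_harmonic.1 hg).2,
      pderiv_eq_zero_of_mem_harmonic_zero i hg]
    simp
  · have hu := mem_harmonic.1 (pderiv_mem_harmonic i hg)
    refine mem_harmonic.2 ⟨Submodule.sub_mem (homogeneousSubmodule (Fin n) ℝ _) hX (Submodule.smul_mem _ _ ?_), ?_⟩
    · have := isHomogeneous_normSq.mul hu.1
      rwa [show 2 + e = e + 1 + 1 by ring] at this
    · have hn' : (2 : ℝ) ≤ n := by exact_mod_cast hn
      have hm : (n + 2 * ((e + 1 : ℕ) : ℝ) - 2) ≠ 0 := by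
        push_cast
        have : (0 : ℝ) ≤ e := e.cast_nonneg
        linarith
      rw [map_sub, map_smul, laplacian_X_mul, laplacian_normSq_mul hu.1, hu.2,
        (mem_harmonic.1 hg).2, mul_zero, mul_zero, add_zero, add_zero, ← Nat.cast_smul_eq_nsmul ℝ,
        smul_smul, sub_eq_zero]
      have hc : 1 / (n + 2 * ((e + 1 : ℕ) : ℝ) - 2) * ((2 * n + 4 * e : ℕ) : ℝ) = 2 := by
        rw [one_div_mul_eq_div, div_eq_iff hm]
        push_cast
        ring
      rw [hc, two_smul, two_mul]

lemma gaussInt_mul_raise (i : Fin n) (hp : p ∈ harmonic n (e + 1)) (hg : g ∈ harmonic n e) :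
    gaussInt (p * raise e i g) = gaussInt (pderiv i p * g) := by
  have h0 := gaussInt_mul_pderiv_eq_zero i hp hg (by omega)
  have h1 : gaussInt (normSq * (p * pderiv i g)) = 0 := by
    obtain _ | e := e
    · rw [pderiv_eq_zero_of_mem_harmonic_zero i hg, mul_zero, mul_zero, map_zero]
    · rw [gaussInt_normSq_mul (hp.1.mul (pderiv_mem_harmonic i hg).1), h0, mul_zero]
  have h2 := gaussInt_pderiv i (p * g)
  rw [pderiv_mul, map_add, h0, add_zero] at h2
  rw [raise_apply, mul_sub, mul_smul_comm, map_sub, map_smul, mul_left_comm p normSq, h1, h2,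
    mul_left_comm]
  simp

lemma gaussInt_mul_self_le (hn : 2 ≤ n) (i : Fin n) (hg : g ∈ harmonic n e) :
    gaussInt (g * g) ≤ gaussInt (pderiv i (raise e i g) * g) := by
  obtain _ | e := e
  · rw [raise_apply, pderiv_eq_zero_of_mem_harmonic_zero i hg, mul_zero, smul_zero, sub_zero,
      pderiv_mul, pderiv_X_self, pderiv_eq_zero_of_mem_harmonic_zero i hg]
    simp
  · set c : ℝ := 1 / (n + 2 * ((e + 1 : ℕ) : ℝ) - 2) with hc
    have hu := pderiv_mem_harmonic i hg
    have h0 : gaussInt (g * pderiv i (pderiv i g)) = 0 :=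
      gaussInt_mul_pderiv_eq_zero i hg hu (by omega)
    have h1 : gaussInt (normSq * (g * pderiv i (pderiv i g))) = 0 := by
      obtain _ | e := e
      · rw [pderiv_eq_zero_of_mem_harmonic_zero i hu, mul_zero, mul_zero, map_zero]
      · rw [gaussInt_normSq_mul (hg.1.mul (pderiv_mem_harmonic i hu).1), h0, mul_zero]
    have h2 := gaussInt_pderiv i (g * pderiv i g)
    rw [pderiv_mul, map_add, h0, add_zero] at h2
    have h3 : pderiv i (raise (e + 1) i g) * g = g * g + (1 - 2 * c) • (X i * (g * pderiv i g)) -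
        c • (normSq * (g * pderiv i (pderiv i g))) := by
      rw [raise_apply, ← hc, map_sub, Derivation.map_smul, pderiv_normSq_mul, pderiv_mul,
        pderiv_X_self]
      simp only [smul_eq_C_mul, map_sub, map_mul, map_one, map_ofNat]
      ring
    have hn' : (2 : ℝ) ≤ n := by exact_mod_cast hn
    have he : (0 : ℝ) ≤ e := e.cast_nonneg
    have hc2 : c ≤ 1 / 2 := by
      rw [hc]
      refine one_div_le_one_div_of_le two_pos ?_
      push_cast
      linarith
    rw [h3, map_sub, map_add, map_smul, map_smul, h1, ← h2, smul_zero, sub_zero, smul_eq_mul]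
    have := mul_nonneg (by linarith : 0 ≤ 1 - 2 * c) (gaussInt_mul_self_nonneg (pderiv i g))
    linarith

lemma exists_pderiv_raise_eq (hn : 2 ≤ n) (i : Fin n) (hp : p ∈ harmonic n e) :
    ∃ g ∈ harmonic n e, pderiv i (raise e i g) = p := by
  let T : harmonic n e →ₗ[ℝ] harmonic n e :=
    ((pderiv i).toLinearMap ∘ₗ raise e i).restrict fun g hg =>
      pderiv_mem_harmonic i (raise_mem_harmonic hn i hg)
  have hT (g : harmonic n e) : (T g : MvPolynomial (Fin n) ℝ) = pderiv i (raise e i g) := rfl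
  have hinj : Function.Injective T := by
    refine (injective_iff_map_eq_zero T).2 fun g hg => Subtype.ext ?_
    refine eq_zero_of_gaussInt_mul_self _ (le_antisymm ?_ (gaussInt_mul_self_nonneg _))
    refine (gaussInt_mul_self_le hn i g.2).trans_eq ?_
    rw [← hT, hg, Submodule.coe_zero, zero_mul, map_zero]
  obtain ⟨g, hg⟩ := LinearMap.injective_iff_surjective.1 hinj ⟨p, hp⟩
  exact ⟨g, g.2, congrArg Subtype.val hg⟩

theorem gaussInt_mul_self_le_pderiv (hn : 2 ≤ n) (i : Fin n) (hp : p ∈ harmonic n (e + 1))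
    (horth : ∀ q ∈ harmonic n (e + 1), pderiv i q = 0 → gaussInt (p * q) = 0) :
    gaussInt (p * p) ≤ gaussInt (pderiv i p * pderiv i p) := by
  obtain ⟨g, hg, hgp⟩ := exists_pderiv_raise_eq hn i (pderiv_mem_harmonic i hp)
  have h1 := horth (p - raise e i g) (Submodule.sub_mem _ hp (raise_mem_harmonic hn i hg))
    (by rw [map_sub, hgp, sub_self])
  have h2 := gaussInt_mul_self_le hn i hg
  have h3 := gaussInt_mul_self_nonneg (pderiv i p - g)
  rw [mul_sub, map_sub, gaussInt_mul_raise i hp hg] at h1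
  rw [hgp] at h2
  have h4 : (pderiv i p - g) * (pderiv i p - g) =
      pderiv i p * pderiv i p - (2 : ℝ) • (pderiv i p * g) + g * g := by
    rw [two_smul]
    ring
  rw [h4, map_add, map_sub, map_smul, smul_eq_mul] at h3
  linarith

lemma pd_toFun (i : Fin n) (p : MvPolynomial (Fin n) ℝ) :
    pd n i (toFun p) = toFun (pderiv i p) :=
  funext fun x => fderiv_toFun p x i

lemma lap_toFun (p : MvPolynomial (Fin n) ℝ) : lap n (toFun p) = toFun (laplacian p) := by
  ext x
  simp only [lap, fderiv_toFun]
  rw [laplacian_apply, toFun, map_sum]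
  rfl

lemma isHHP_iff {f : E n → ℝ} : IsHHP n e f ↔ ∃ p ∈ harmonic n e, f = toFun p := by
  have h0 : (fun _ : E n => (0 : ℝ)) = toFun 0 := by ext; simp [toFun]
  constructor
  · rintro ⟨⟨p, hp, hf⟩, hl⟩
    obtain rfl : f = toFun p := funext hf
    refine ⟨p, ⟨hp, toFun_injective ?_⟩, rfl⟩
    rw [← lap_toFun, ← h0]
    exact funext hl
  · rintro ⟨p, hp, rfl⟩
    refine ⟨⟨p, hp.1, fun _ => rfl⟩, fun x => ?_⟩
    rw [lap_toFun, (mem_harmonic.1 hp).2, ← h0]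

lemma sInner_toFun (p q : MvPolynomial (Fin n) ℝ) :
    sInner n (toFun p) (toFun q) = sAvg n (toFun (p * q)) := by
  rw [sInner]
  congr 1
  ext x
  simp [toFun]

lemma sNorm_toFun (p : MvPolynomial (Fin n) ℝ) :
    sNorm n (toFun p) = Real.sqrt (sAvg n (toFun (p * p))) := by
  rw [sNorm]
  congr 2
  ext x
  simp [toFun, sq]

lemma sAvg_toFun_normSq_mul (p : MvPolynomial (Fin n) ℝ) :
    sAvg n (toFun (normSq * p)) = sAvg n (toFun p) := by
  unfold sAvg
  congr 1
  ext y
  exact toFun_normSq_mul (norm_eq_of_mem_sphere y) p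

end GaussianHarmonic

open GaussianHarmonic in
theorem stmt9 (n d : ℕ) (hn : 2 ≤ n) (h : E n → ℝ) (hh : IsHHP n d h)
    (horth : ∀ q : E n → ℝ, IsHHP n d q →
      (∀ x : E n, pd n (⟨0, by omega⟩ : Fin n) q x = 0) → sInner n h q = 0) :
    sNorm n h ≤ sNorm n (pd n (⟨0, by omega⟩ : Fin n) h) := by
  have h0 : toFun (0 : MvPolynomial (Fin n) ℝ) = 0 := by ext; simp [toFun]
  obtain ⟨p, hp, rfl⟩ := isHHP_iff.1 hh
  have horth' (q) (hq : q ∈ harmonic n d) (hq0 : MvPolynomial.pderiv ⟨0, by omega⟩ q = 0) :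
      sAvg n (toFun (p * q)) = 0 := by
    rw [← sInner_toFun]
    refine horth _ (isHHP_iff.2 ⟨q, hq, rfl⟩) fun x => ?_
    rw [pd_toFun, hq0, h0, Pi.zero_apply]
  rw [pd_toFun, sNorm_toFun, sNorm_toFun]
  obtain _ | e := d
  · rw [horth' p hp (pderiv_eq_zero_of_mem_harmonic_zero _ hp), Real.sqrt_zero]
    exact Real.sqrt_nonneg _
  obtain ⟨c, hc, hcp⟩ := exists_pos_gaussInt_eq_mul_sAvg (n := n) (by omega) (e + 1)
  set u := MvPolynomial.pderiv (⟨0, by omega⟩ : Fin n) p with hu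
  have hue := pderiv_mem_harmonic ⟨0, by omega⟩ hp
  rw [← hu] at hue
  have huu := hue.1.mul hue.1
  have hle := gaussInt_mul_self_le_pderiv hn ⟨0, by omega⟩ hp fun q hq hq0 => by
    rw [hcp _ (hp.1.mul hq.1), horth' q hq hq0, mul_zero]
  have hns := isHomogeneous_normSq.mul huu
  rw [show 2 + (e + e) = e + 1 + (e + 1) by ring] at hns
  refine Real.sqrt_le_sqrt (le_of_mul_le_mul_left ?_ hc)
  rw [← hcp _ (hp.1.mul hp.1), ← sAvg_toFun_normSq_mul (u * u), ← hcp _ hns,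
    gaussInt_normSq_mul huu]
  refine hle.trans (le_mul_of_one_le_left (gaussInt_mul_self_nonneg u) ?_)
  exact_mod_cast (by omega : 1 ≤ n + (e + e))
end
end
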